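/- arXiv:2512.14581 — 3 statements merged into one kernel-verified Lean document; each statement's English description precedes it below -/
import Mathlib

section
/- Let p ∈ ℝ_{≥0} and let f ∈ C^∞(ℝ) be such that f' is of precise order −p−1. Then for all n, m ≥ 1 and all x_1, …, x_n ∈ ℝ, the weighted divided difference f'{x_1, …, x_n, y_1, …, y_m} converges to f'{x_1, …, x_n} as min_j |y_j| → ∞; that is, for every ε > 0 there exists Y > 0 such that for all y_1, …, y_m ∈ ℝ with |y_j| > Y for all j, one has |f'{x_1, …, x_n, y_1, …, y_m} − f'{x_1, …, x_n}| < ε. -/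
open MeasureTheory

/-- Divided difference of order `n-1` of `f` at the `n` points `x`, defined via the
integral formula over the simplex (and set to `0` for the empty tuple). -/
noncomputable def divDiff (f : ℝ → ℝ) : {n : ℕ} → (Fin n → ℝ) → ℝ
  | 0, _ => 0
  | m + 1, x =>
    ∫ t in {t : Fin m → ℝ | Monotone t ∧ ∀ j, t j ∈ Set.Icc (0 : ℝ) 1},
      iteratedDeriv m f (x (Fin.last m) + ∑ j : Fin m, (x j.castSucc - x j.succ) * t j)

/-- Weighted divided difference `f'{x_1,…,x_n} = (−1)^n x_1⋯x_n f'[x_1,…,x_n]`. -/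
noncomputable def wDivDiff (f : ℝ → ℝ) {n : ℕ} (x : Fin n → ℝ) : ℝ :=
  (-1 : ℝ) ^ n * (∏ j, x j) * divDiff (deriv f) x

/-- `f` is of precise order `r`: for every `k` there are `R, c₁, c₂ > 0` with
`c₁ |x|^(r-k) ≤ |f^(k)(x)| ≤ c₂ |x|^(r-k)` for all `|x| > R`. -/
def PreciseOrder (f : ℝ → ℝ) (r : ℝ) : Prop :=
  ∀ k : ℕ, ∃ R c₁ c₂ : ℝ, 0 < R ∧ 0 < c₁ ∧ 0 < c₂ ∧
    ∀ x : ℝ, R < |x| →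
      c₁ * |x| ^ (r - (k : ℝ)) ≤ |iteratedDeriv k f x| ∧
        |iteratedDeriv k f x| ≤ c₂ * |x| ^ (r - (k : ℝ))

/-- The smooth difference quotient `u ↦ (g u - g a) / (u - a)`, as an integral. -/
noncomputable def diffQuot (a : ℝ) (g : ℝ → ℝ) (u : ℝ) : ℝ :=
  ∫ t in (0 : ℝ)..1, deriv g (a + (u - a) * t)

lemma continuous_iteratedDeriv_of_smooth {g : ℝ → ℝ} (hg : ContDiff ℝ (⊤ : ℕ∞) g) (k : ℕ) :
    Continuous (iteratedDeriv k g) :=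
  hg.continuous_iteratedDeriv k (by exact_mod_cast le_top)

lemma hasDerivAt_iteratedDeriv_of_smooth {g : ℝ → ℝ} (hg : ContDiff ℝ (⊤ : ℕ∞) g) (k : ℕ)
    (u : ℝ) : HasDerivAt (iteratedDeriv k g) (iteratedDeriv (k + 1) g u) u := by
  rw [iteratedDeriv_succ]
  exact (hg.differentiable_iteratedDeriv k
    (by exact_mod_cast WithTop.coe_lt_top k) u).hasDerivAt

lemma hasDerivAt_integral_diffQuot {g : ℝ → ℝ} (hg : ContDiff ℝ (⊤ : ℕ∞) g) (a : ℝ) (k : ℕ)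
    (u : ℝ) :
    HasDerivAt (fun u => ∫ t in (0 : ℝ)..1, t ^ k * iteratedDeriv (k + 1) g (a + (u - a) * t))
      (∫ t in (0 : ℝ)..1, t ^ (k + 1) * iteratedDeriv (k + 2) g (a + (u - a) * t)) u := by
  have hc := continuous_iteratedDeriv_of_smooth hg
  have hcF : ∀ (j l : ℕ) (v : ℝ),
      Continuous fun t : ℝ => t ^ j * iteratedDeriv l g (a + (v - a) * t) := fun j l v =>
    (continuous_pow j).mul ((hc l).comp (by fun_prop))
  have hK := (isCompact_closedBall u 1).prod (isCompact_Icc (a := (0 : ℝ)) (b := 1))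
  obtain ⟨C, hC⟩ := hK.exists_bound_of_continuousOn
    (f := fun q : ℝ × ℝ => q.2 ^ (k + 1) * iteratedDeriv (k + 2) g (a + (q.1 - a) * q.2))
    (((continuous_snd.pow _).mul ((hc _).comp (by fun_prop))).continuousOn)
  refine (intervalIntegral.hasDerivAt_integral_of_dominated_loc_of_deriv_le
    (F' := fun v t => t ^ (k + 1) * iteratedDeriv (k + 2) g (a + (v - a) * t))
    (bound := fun _ => C) (s := Metric.closedBall u 1)
    (Metric.closedBall_mem_nhds u one_pos)
    (.of_forall fun v => (hcF _ _ v).aestronglyMeasurable) ((hcF _ _ u).intervalIntegrable _ _)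
    (hcF _ _ u).aestronglyMeasurable ?_ (by simp) ?_).2
  · refine .of_forall fun t ht v hv => hC (v, t) ⟨hv, ?_⟩
    rw [Set.uIoc_of_le zero_le_one] at ht
    exact ⟨ht.1.le, ht.2⟩
  · refine .of_forall fun t ht v hv => ?_
    have h1 : HasDerivAt (fun v : ℝ => a + (v - a) * t) t v := by
      simpa using (((hasDerivAt_id v).sub_const a).mul_const t).const_add a
    have h2 := ((hasDerivAt_iteratedDeriv_of_smooth hg (k + 1) _).comp v h1).const_mul (t ^ k)
    refine h2.congr_deriv ?_
    ring

lemma iteratedDeriv_diffQuot {g : ℝ → ℝ} (hg : ContDiff ℝ (⊤ : ℕ∞) g) (a : ℝ) (k : ℕ) :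
    iteratedDeriv k (diffQuot a g) =
      fun u => ∫ t in (0 : ℝ)..1, t ^ k * iteratedDeriv (k + 1) g (a + (u - a) * t) := by
  induction k with
  | zero => ext u; simp [diffQuot, iteratedDeriv_one]
  | succ k ih =>
    rw [iteratedDeriv_succ, ih]
    ext u
    exact (hasDerivAt_integral_diffQuot hg a k u).deriv

lemma contDiff_diffQuot {g : ℝ → ℝ} (hg : ContDiff ℝ (⊤ : ℕ∞) g) (a : ℝ) :
    ContDiff ℝ (⊤ : ℕ∞) (diffQuot a g) := by
  refine contDiff_of_differentiable_iteratedDeriv fun k _ => ?_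
  rw [iteratedDeriv_diffQuot hg]
  exact fun u => (hasDerivAt_integral_diffQuot hg a k u).differentiableAt

lemma sub_mul_diffQuot {g : ℝ → ℝ} (hg : ContDiff ℝ (⊤ : ℕ∞) g) (a u : ℝ) :
    (u - a) * diffQuot a g u = g u - g a := by
  have hd := hasDerivAt_iteratedDeriv_of_smooth hg 0
  have hc := continuous_iteratedDeriv_of_smooth hg 1
  simp only [iteratedDeriv_zero, zero_add, iteratedDeriv_one] at hd hc
  have h := intervalIntegral.integral_eq_sub_of_hasDerivAt (a := 0) (b := 1)
    (f := fun t => g (a + (u - a) * t)) (f' := fun t => (u - a) * deriv g (a + (u - a) * t))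
    (fun t _ => by
      have h1 : HasDerivAt (fun t : ℝ => a + (u - a) * t) (u - a) t := by
        simpa using ((hasDerivAt_id t).const_mul (u - a)).const_add a
      exact ((hd _).comp t h1).congr_deriv (mul_comm _ _))
    ((continuous_const.mul (hc.comp (by fun_prop))).intervalIntegrable _ _)
  rw [intervalIntegral.integral_const_mul] at h
  simpa [diffQuot] using h

lemma sub_mul_iteratedDeriv_diffQuot {g : ℝ → ℝ} (hg : ContDiff ℝ (⊤ : ℕ∞) g) (a : ℝ) (k : ℕ)
    (u : ℝ) :
    (u - a) * iteratedDeriv (k + 1) (diffQuot a g) u +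
      (k + 1) * iteratedDeriv k (diffQuot a g) u = iteratedDeriv (k + 1) g u := by
  have hd := hasDerivAt_iteratedDeriv_of_smooth (contDiff_diffQuot hg a)
  have hdg := hasDerivAt_iteratedDeriv_of_smooth hg
  have hid : ∀ u, HasDerivAt (fun u : ℝ => u - a) 1 u := fun u => (hasDerivAt_id u).sub_const a
  induction k generalizing u with
  | zero =>
    have h1 := (hid u).mul (hd 0 u)
    have h2 := (hdg 0 u).sub_const (g a)
    have h3 : (fun u : ℝ => u - a) * iteratedDeriv 0 (diffQuot a g) =
        fun u => iteratedDeriv 0 g u - g a := by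
      ext v
      simpa using sub_mul_diffQuot hg a v
    rw [h3] at h1
    have := h1.unique h2
    push_cast
    linarith
  | succ k ih =>
    have h1 := ((hid u).mul (hd (k + 1) u)).add ((hd k u).const_mul ((k : ℝ) + 1))
    have h2 := hdg (k + 1) u
    have h3 : ((fun u : ℝ => u - a) * iteratedDeriv (k + 1) (diffQuot a g) +
        fun u => ((k : ℝ) + 1) * iteratedDeriv k (diffQuot a g) u) = iteratedDeriv (k + 1) g := by
      ext v
      exact ih v
    rw [h3] at h1
    have := h1.unique h2
    push_cast
    linarith

lemma integral_pow_div_affine_pow {A U : ℝ} (hA : 0 < A) (hU : 0 < U) (k : ℕ) :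
    IntervalIntegrable (fun t : ℝ => t ^ k / (A + (U - A) * t) ^ (k + 2)) volume 0 1 ∧
    ∫ t in (0 : ℝ)..1, t ^ k / (A + (U - A) * t) ^ (k + 2) = 1 / ((k + 1) * A * U ^ (k + 1)) := by
  have hpos : ∀ t ∈ Set.uIcc (0 : ℝ) 1, 0 < A + (U - A) * t := fun t ht => by
    rw [Set.uIcc_of_le zero_le_one] at ht
    rcases eq_or_lt_of_le ht.1 with h | h
    · simpa [← h] using hA
    · nlinarith [ht.2, mul_pos hU h, mul_nonneg hA.le (sub_nonneg.2 ht.2)]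
  have hint : IntervalIntegrable (fun t : ℝ => t ^ k / (A + (U - A) * t) ^ (k + 2)) volume 0 1 := by
    refine ContinuousOn.intervalIntegrable (ContinuousOn.div (by fun_prop) (by fun_prop) ?_)
    exact fun t ht => (pow_pos (hpos t ht) _).ne'
  refine ⟨hint, ?_⟩
  rw [intervalIntegral.integral_eq_sub_of_hasDerivAt
    (f := fun t => (t / (A + (U - A) * t)) ^ (k + 1) / ((k + 1) * A)) _ hint]
  · have : (A + (U - A) * 1) = U := by ring
    rw [this]
    simp
    field_simp
  · intro t ht
    have hw := hpos t ht
    have h1 : HasDerivAt (fun t : ℝ => A + (U - A) * t) (U - A) t := by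
      simpa using ((hasDerivAt_id t).const_mul (U - A)).const_add A
    have h2 := (((hasDerivAt_id t).div h1 hw.ne').pow (k + 1)).div_const ((k + 1) * A)
    refine h2.congr_deriv ?_
    simp only [id, Pi.div_apply, Nat.add_sub_cancel, div_pow]
    push_cast
    have : (k : ℝ) + 1 ≠ 0 := by positivity
    field_simp
    ring

/-- Smooth functions whose `k`-th derivative is `O(|x|^(-k-1))`, with prescribed constants. -/
structure SymbolBound (B : ℕ → ℝ) (g : ℝ → ℝ) : Prop where
  smooth : ContDiff ℝ (⊤ : ℕ∞) g
  bound : ∀ (k : ℕ) (x : ℝ), |iteratedDeriv k g x| * (1 + |x|) ^ (k + 1) ≤ B k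

lemma SymbolBound.nonneg {B : ℕ → ℝ} {g : ℝ → ℝ} (hg : SymbolBound B g) (k : ℕ) : 0 ≤ B k :=
  le_trans (by positivity) (hg.bound k 0)

lemma SymbolBound.diffQuot_of_mul_nonneg {B : ℕ → ℝ} {g : ℝ → ℝ} (hg : SymbolBound B g) {a u : ℝ}
    (hau : 0 ≤ a * u) (k : ℕ) :
    |iteratedDeriv k (diffQuot a g) u| * ((1 + |a|) * (1 + |u|) ^ (k + 1)) ≤ B (k + 1) := by
  have hA : 0 < 1 + |a| := by positivity
  have hU : 0 < 1 + |u| := by positivity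
  obtain ⟨hint, heq⟩ := integral_pow_div_affine_pow hA hU k
  have habs : ∀ t ∈ Set.Icc (0 : ℝ) 1,
      1 + |a + (u - a) * t| = 1 + |a| + ((1 + |u|) - (1 + |a|)) * t := fun t ht => by
    have h1 : a + (u - a) * t = a * (1 - t) + u * t := by ring
    have h2 : 0 ≤ (a * (1 - t)) * (u * t) := by
      have := mul_nonneg hau (mul_nonneg (sub_nonneg.2 ht.2) ht.1)
      linarith
    rw [h1, (abs_add_eq_add_abs_iff _ _).2, abs_mul, abs_mul, abs_of_nonneg ht.1,
      abs_of_nonneg (sub_nonneg.2 ht.2)]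
    · ring
    · exact mul_nonneg_iff.1 h2
  have hle : |iteratedDeriv k (diffQuot a g) u| ≤
      ∫ t in (0 : ℝ)..1, B (k + 1) *
        (t ^ k / (1 + |a| + ((1 + |u|) - (1 + |a|)) * t) ^ (k + 2)) := by
    rw [iteratedDeriv_diffQuot hg.smooth, ← Real.norm_eq_abs]
    refine intervalIntegral.norm_integral_le_of_norm_le zero_le_one
      (.of_forall fun t ht => ?_) (hint.const_mul _)
    have ht' : t ∈ Set.Icc (0 : ℝ) 1 := ⟨ht.1.le, ht.2⟩
    rw [← habs t ht', Real.norm_eq_abs, abs_mul, abs_of_nonneg (pow_nonneg ht'.1 k),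
      mul_div_left_comm]
    refine mul_le_mul_of_nonneg_left ?_ (pow_nonneg ht'.1 k)
    rw [le_div_iff₀ (by positivity)]
    exact hg.bound (k + 1) _
  rw [intervalIntegral.integral_const_mul, heq] at hle
  rw [← le_div_iff₀ (by positivity)]
  refine hle.trans ?_
  rw [mul_one_div, mul_assoc]
  refine div_le_div_of_nonneg_left (hg.nonneg _) (by positivity) ?_
  refine le_mul_of_one_le_left (by positivity) ?_
  linarith [(Nat.cast_nonneg k : (0 : ℝ) ≤ k)]

lemma exists_bound_iteratedDeriv_diffQuot (B : ℕ → ℝ) (k : ℕ) :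
    ∃ C : ℝ, ∀ g, SymbolBound B g → ∀ a u : ℝ, 1 ≤ |a| →
      |iteratedDeriv k (diffQuot a g) u| * ((1 + |a|) * (1 + |u|) ^ (k + 1)) ≤ C := by
  have hdist : ∀ a u : ℝ, a * u ≤ 0 → |u - a| = |u| + |a| := fun a u h => by
    have := (abs_add_eq_add_abs_iff u (-a)).2 (mul_nonneg_iff.1 (by linarith))
    rwa [abs_neg, ← sub_eq_add_neg] at this
  induction k with
  | zero =>
    refine ⟨B 1 + 3 * B 0, fun g hg a u ha => ?_⟩
    have hB1 := hg.nonneg 1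
    have hB0 := hg.nonneg 0
    rcases le_total 0 (a * u) with h | h
    · linarith [hg.diffQuot_of_mul_nonneg h 0]
    · have h1 := congrArg abs (sub_mul_diffQuot hg.smooth a u)
      rw [abs_mul, hdist a u h] at h1
      have hu := hg.bound 0 u
      have hga := hg.bound 0 a
      simp only [iteratedDeriv_zero, zero_add, pow_one] at hu hga ⊢
      have h2 : (|u| + |a|) * |diffQuot a g u| ≤ |g u| + |g a| := h1.le.trans (abs_sub _ _)
      have hu0 := abs_nonneg u
      have hpos : 0 < |u| + |a| := by linarith
      have h3 : (|u| + |a|) * (|diffQuot a g u| * ((1 + |a|) * (1 + |u|))) ≤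
          (|u| + |a|) * (3 * B 0) := by
        calc _ = ((|u| + |a|) * |diffQuot a g u|) * ((1 + |a|) * (1 + |u|)) := by ring
          _ ≤ (|g u| + |g a|) * ((1 + |a|) * (1 + |u|)) := by gcongr
          _ = (1 + |a|) * (|g u| * (1 + |u|)) + (1 + |u|) * (|g a| * (1 + |a|)) := by ring
          _ ≤ (1 + |a|) * B 0 + (1 + |u|) * B 0 := by gcongr
          _ ≤ _ := by nlinarith
      linarith [le_of_mul_le_mul_left h3 hpos]
  | succ k ih =>
    obtain ⟨C, hC⟩ := ih
    refine ⟨B (k + 2) + 2 * B (k + 1) + 2 * (k + 1) * C, fun g hg a u ha => ?_⟩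
    have hC0 : 0 ≤ C := le_trans (by positivity) (hC g hg a u ha)
    have hB2 := hg.nonneg (k + 2)
    have hB1 := hg.nonneg (k + 1)
    rcases le_total 0 (a * u) with h | h
    · have : 0 ≤ 2 * ((k : ℝ) + 1) * C := by positivity
      linarith [hg.diffQuot_of_mul_nonneg h (k + 1)]
    · have h1 := sub_mul_iteratedDeriv_diffQuot hg.smooth a k u
      have hu := hg.bound (k + 1) u
      have hq := hC g hg a u ha
      set q := iteratedDeriv k (diffQuot a g) u
      set q' := iteratedDeriv (k + 1) (diffQuot a g) u
      set d := iteratedDeriv (k + 1) g u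
      have h2 : (|u| + |a|) * |q'| ≤ |d| + (k + 1) * |q| := by
        rw [← hdist a u h, ← abs_mul, eq_sub_of_add_eq h1]
        refine (abs_sub _ _).trans ?_
        rw [abs_mul, abs_of_nonneg (by positivity : (0 : ℝ) ≤ k + 1)]
      have hu0 := abs_nonneg u
      have hpos : 0 < |u| + |a| := by linarith
      have h3 : (|u| + |a|) * (|q'| * ((1 + |a|) * (1 + |u|) ^ (k + 1 + 1))) ≤
          (|u| + |a|) * (2 * B (k + 1) + 2 * (k + 1) * C) := by
        calc _ = ((|u| + |a|) * |q'|) * ((1 + |a|) * (1 + |u|) ^ (k + 1 + 1)) := by ring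
          _ ≤ (|d| + (k + 1) * |q|) * ((1 + |a|) * (1 + |u|) ^ (k + 1 + 1)) := by gcongr
          _ = (1 + |a|) * (|d| * (1 + |u|) ^ (k + 1 + 1)) +
              ((k + 1) * (1 + |u|)) * (|q| * ((1 + |a|) * (1 + |u|) ^ (k + 1))) := by ring
          _ ≤ (2 * (|u| + |a|)) * B (k + 1) + ((k + 1) * (2 * (|u| + |a|))) * C := by
            gcongr <;> linarith
          _ = _ := by ring
      linarith [le_of_mul_le_mul_left h3 hpos]

lemma exists_symbolBound_diffQuot (B : ℕ → ℝ) :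
    ∃ B' K : ℕ → ℝ, ∀ g, SymbolBound B g → ∀ a : ℝ, 1 ≤ |a| →
      SymbolBound B' (fun v => -a * diffQuot a g v) ∧
      ∀ k u, |iteratedDeriv k (fun v => -a * diffQuot a g v) u - iteratedDeriv k g u| * |a| ≤
        K k * (1 + |u|) := by
  choose C hC using exists_bound_iteratedDeriv_diffQuot B
  refine ⟨C, fun k => C k + k * C (k - 1) + B 0, fun g hg a ha => ?_⟩
  have hC0 : ∀ k, 0 ≤ C k := fun k => le_trans (by positivity) (hC k g hg a 0 ha)
  have hB0 := hg.nonneg 0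
  have hloc : ∀ k u, |iteratedDeriv k (diffQuot a g) u| * |a| ≤ C k := fun k u => by
    refine le_trans ?_ (hC k g hg a u ha)
    gcongr
    refine le_trans (by linarith) (le_mul_of_one_le_right (by positivity) ?_)
    exact one_le_pow₀ (by linarith [abs_nonneg u])
  refine ⟨⟨contDiff_const.mul (contDiff_diffQuot hg.smooth a), fun k u => ?_⟩, fun k u => ?_⟩
  · rw [iteratedDeriv_const_mul_field, abs_mul, abs_neg]
    refine le_trans ?_ (hC k g hg a u ha)
    calc _ = |iteratedDeriv k (diffQuot a g) u| * (|a| * (1 + |u|) ^ (k + 1)) := by ring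
      _ ≤ _ := by gcongr; linarith
  · rw [iteratedDeriv_const_mul_field]
    have hu0 := abs_nonneg u
    cases k with
    | zero =>
      have h1 := sub_mul_diffQuot hg.smooth a u
      have h2 : -a * diffQuot a g u - g u = -(u * diffQuot a g u) - g a := by linarith
      have h3 := hloc 0 u
      have h4 := hg.bound 0 a
      simp only [iteratedDeriv_zero, zero_add, pow_one] at h3 h4 ⊢
      rw [h2]
      calc |-(u * diffQuot a g u) - g a| * |a| ≤ (|u| * |diffQuot a g u| + |g a|) * |a| := by
            gcongr
            refine (abs_sub _ _).trans ?_
            rw [abs_neg, abs_mul]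
        _ = |u| * (|diffQuot a g u| * |a|) + |g a| * |a| := by ring
        _ ≤ |u| * C 0 + |g a| * (1 + |a|) := by gcongr; linarith
        _ ≤ _ := by
          have := hC0 0
          push_cast
          nlinarith
    | succ k =>
      have h1 := sub_mul_iteratedDeriv_diffQuot hg.smooth a k u
      have h3 := hloc k u
      have h4 := hloc (k + 1) u
      have hk := hC0 k
      have hk' := hC0 (k + 1)
      set q := iteratedDeriv k (diffQuot a g) u
      set q' := iteratedDeriv (k + 1) (diffQuot a g) u
      have h2 : -a * q' - iteratedDeriv (k + 1) g u = -(u * q') - (k + 1) * q := by linarith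
      simp only [h2, Nat.add_sub_cancel]
      calc |-(u * q') - (k + 1) * q| * |a| ≤ (|u| * |q'| + (k + 1) * |q|) * |a| := by
            gcongr
            refine (abs_sub _ _).trans ?_
            rw [abs_neg, abs_mul, abs_mul, abs_of_nonneg (by positivity : (0 : ℝ) ≤ k + 1)]
        _ = |u| * (|q'| * |a|) + (k + 1) * (|q| * |a|) := by ring
        _ ≤ |u| * C (k + 1) + (k + 1) * C k := by gcongr
        _ ≤ _ := by
          push_cast
          have : 0 ≤ ((k : ℝ) + 1) * C k := by positivity
          nlinarith

lemma isCompact_monotone_unit (l : ℕ) :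
    IsCompact {t : Fin l → ℝ | Monotone t ∧ ∀ j, t j ∈ Set.Icc (0 : ℝ) 1} := by
  have hcube := isCompact_univ_pi fun _ : Fin l => isCompact_Icc (a := (0 : ℝ)) (b := 1)
  refine hcube.of_isClosed_subset ?_ fun t ht j _ => ht.2 j
  simp only [Monotone, Set.mem_Icc, Set.ofPred_and, Set.ofPred_forall]
  refine IsClosed.inter ?_ ?_
  · exact isClosed_iInter fun i => isClosed_iInter fun j => isClosed_iInter fun _ =>
      isClosed_le (continuous_apply i) (continuous_apply j)
  · exact isClosed_iInter fun j => (isClosed_le continuous_const (continuous_apply j)).inter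
      (isClosed_le (continuous_apply j) continuous_const)

lemma snoc_mem_monotone_unit_iff {l : ℕ} (s : Fin l → ℝ) (τ : ℝ) :
    (Monotone (Fin.snoc s τ : Fin (l + 1) → ℝ) ∧
      ∀ j, (Fin.snoc s τ : Fin (l + 1) → ℝ) j ∈ Set.Icc (0 : ℝ) 1) ↔
    τ ∈ Set.Icc (0 : ℝ) 1 ∧ Monotone s ∧ ∀ j, s j ∈ Set.Icc 0 τ := by
  constructor
  · rintro ⟨hm, hI⟩
    refine ⟨by simpa using hI (Fin.last l), fun i j hij => ?_, fun j => ⟨?_, ?_⟩⟩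
    · simpa using hm (Fin.castSucc_le_castSucc_iff.2 hij)
    · simpa using (hI j.castSucc).1
    · simpa using hm (Fin.le_last j.castSucc)
  · rintro ⟨hτ, hm, hI⟩
    refine ⟨fun i j hij => ?_, fun j => ?_⟩
    · induction j using Fin.lastCases with
      | last =>
        induction i using Fin.lastCases with
        | last => exact le_rfl
        | cast i => simpa using (hI i).2
      | cast j =>
        induction i using Fin.lastCases with
        | last => exact absurd hij (not_le.2 (Fin.castSucc_lt_last j))
        | cast i => simpa using hm (Fin.castSucc_le_castSucc_iff.1 hij)
    · induction j using Fin.lastCases with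
      | last => simpa using hτ
      | cast j => simpa using ⟨(hI j).1, (hI j).2.trans hτ.2⟩

open scoped Pointwise in
lemma mem_smul_monotone_unit_iff {l : ℕ} {τ : ℝ} (hτ : 0 < τ) (s : Fin l → ℝ) :
    s ∈ τ • {t : Fin l → ℝ | Monotone t ∧ ∀ j, t j ∈ Set.Icc (0 : ℝ) 1} ↔
      Monotone s ∧ ∀ j, s j ∈ Set.Icc 0 τ := by
  rw [Set.mem_smul_set_iff_inv_smul_mem₀ hτ.ne']
  have hi := inv_pos.2 hτ
  simp only [Set.mem_ofPred_eq, Monotone, Pi.smul_apply, smul_eq_mul, mul_le_mul_iff_right₀ hi,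
    Set.mem_Icc, mul_nonneg_iff_of_pos_left hi, inv_mul_le_one₀ hτ]

open scoped Pointwise in
lemma setIntegral_monotone_unit_succ {l : ℕ} {F : (Fin (l + 1) → ℝ) → ℝ} (hF : Continuous F) :
    ∫ t in {t : Fin (l + 1) → ℝ | Monotone t ∧ ∀ j, t j ∈ Set.Icc (0 : ℝ) 1}, F t =
      ∫ τ in (0 : ℝ)..1, ∫ s in {t : Fin l → ℝ | Monotone t ∧ ∀ j, t j ∈ Set.Icc (0 : ℝ) 1},
        τ ^ l * F (Fin.snoc (τ • s) τ) := by
  set Δ' := {t : Fin (l + 1) → ℝ | Monotone t ∧ ∀ j, t j ∈ Set.Icc (0 : ℝ) 1}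
  set Δ := {t : Fin l → ℝ | Monotone t ∧ ∀ j, t j ∈ Set.Icc (0 : ℝ) 1}
  set e := MeasurableEquiv.piFinSuccAbove (fun _ : Fin (l + 1) => ℝ) (Fin.last l)
  have hmp : MeasurePreserving e.symm :=
    (volume_preserving_piFinSuccAbove (fun _ : Fin (l + 1) => ℝ) (Fin.last l)).symm
  have hes : ∀ (τ : ℝ) (s : Fin l → ℝ), e.symm (τ, s) = (Fin.snoc s τ : Fin (l + 1) → ℝ) :=
    fun τ s => Fin.insertNth_last' τ s
  have hmem : ∀ (τ : ℝ) (s : Fin l → ℝ), (τ, s) ∈ e.symm ⁻¹' Δ' ↔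
      τ ∈ Set.Icc (0 : ℝ) 1 ∧ Monotone s ∧ ∀ j, s j ∈ Set.Icc 0 τ := fun τ s => by
    rw [Set.mem_preimage, hes]
    exact snoc_mem_monotone_unit_iff s τ
  have hmeas : MeasurableSet (e.symm ⁻¹' Δ') :=
    e.symm.measurable (isCompact_monotone_unit (l + 1)).isClosed.measurableSet
  have hint : IntegrableOn (fun z => F (e.symm z)) (e.symm ⁻¹' Δ') :=
    (hmp.integrableOn_comp_preimage e.symm.measurableEmbedding).2
      (hF.continuousOn.integrableOn_compact (isCompact_monotone_unit (l + 1)))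
  rw [← hmp.setIntegral_preimage_emb e.symm.measurableEmbedding, ← integral_indicator hmeas]
  rw [Measure.volume_eq_prod, integral_prod _ ((integrable_indicator_iff hmeas).2 hint),
    intervalIntegral.integral_of_le zero_le_one, ← integral_indicator measurableSet_Ioc]
  refine integral_congr_ae ?_
  filter_upwards [compl_mem_ae_iff.2 (measure_singleton (μ := (volume : Measure ℝ)) 0)] with τ hτ0
  by_cases hτ : τ ∈ Set.Ioc (0 : ℝ) 1
  · rw [Set.indicator_of_mem hτ, integral_const_mul,
      Measure.setIntegral_comp_smul_of_pos volume (fun s => F (Fin.snoc s τ)) Δ hτ.1]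
    have hset : MeasurableSet (τ • Δ) :=
      (isCompact_monotone_unit l).smul τ |>.isClosed.measurableSet
    rw [← integral_indicator hset, Module.finrank_fin_fun, smul_eq_mul,
      mul_inv_cancel_left₀ (pow_pos hτ.1 l).ne']
    congr 1
    ext s
    by_cases hs : s ∈ τ • Δ
    · rw [Set.indicator_of_mem hs, Set.indicator_of_mem
        ((hmem τ s).2 ⟨⟨hτ.1.le, hτ.2⟩, (mem_smul_monotone_unit_iff hτ.1 s).1 hs⟩), hes]
    · rw [Set.indicator_of_notMem hs, Set.indicator_of_notMem]
      exact fun h => hs ((mem_smul_monotone_unit_iff hτ.1 s).2 ((hmem τ s).1 h).2)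
  · rw [Set.indicator_of_notMem hτ]
    refine integral_eq_zero_of_ae (.of_forall fun s => ?_)
    refine Set.indicator_of_notMem (fun h => hτ ?_) _
    have h1 := ((hmem τ s).1 h).1
    exact ⟨lt_of_le_of_ne h1.1 (Ne.symm hτ0), h1.2⟩

lemma divDiff_snoc {g : ℝ → ℝ} (hg : ContDiff ℝ (⊤ : ℕ∞) g) {n : ℕ} (hn : 1 ≤ n)
    (x : Fin n → ℝ) (a : ℝ) :
    divDiff g (Fin.snoc x a : Fin (n + 1) → ℝ) = divDiff (diffQuot a g) x := by
  obtain ⟨l, rfl⟩ : ∃ l, n = l + 1 := ⟨n - 1, by omega⟩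
  have hc := continuous_iteratedDeriv_of_smooth hg (l + 1)
  simp only [divDiff]
  rw [setIntegral_monotone_unit_succ (F := fun t => iteratedDeriv (l + 1) g _)
    (hc.comp (by fun_prop)), iteratedDeriv_diffQuot hg,
    ← intervalIntegral_integral_swap]
  · refine intervalIntegral.integral_congr fun τ _ => ?_
    refine integral_congr_ae (.of_forall fun s => ?_)
    simp only [Fin.sum_univ_castSucc, Fin.snoc_last, Fin.snoc_castSucc,
      Fin.succ_last, Fin.succ_castSucc, Pi.smul_apply, smul_eq_mul]
    congr 2
    have : ∑ j : Fin l, (x j.castSucc - x j.succ) * (τ * s j) =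
        (∑ j : Fin l, (x j.castSucc - x j.succ) * s j) * τ := by
      rw [Finset.sum_mul]
      exact Finset.sum_congr rfl fun j _ => by ring
    rw [this]
    ring
  · rw [Measure.prod_restrict]
    refine IntegrableOn.mono_set (t := Set.Icc (0 : ℝ) 1 ×ˢ _) ?_
      (Set.prod_mono ?_ subset_rfl)
    · refine ContinuousOn.integrableOn_compact (isCompact_Icc.prod (isCompact_monotone_unit l)) ?_
      refine Continuous.continuousOn ?_
      exact (continuous_fst.pow _).mul (hc.comp (by fun_prop))
    · rw [Set.uIoc_of_le zero_le_one]
      exact Set.Ioc_subset_Icc_self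

lemma divDiff_const_mul (c : ℝ) (g : ℝ → ℝ) {n : ℕ} (x : Fin n → ℝ) :
    divDiff (fun v => c * g v) x = c * divDiff g x := by
  cases n with
  | zero => simp [divDiff]
  | succ l =>
    simp only [divDiff, iteratedDeriv_const_mul_field]
    rw [integral_const_mul]

lemma exists_absorb_far_points (m : ℕ) (B : ℕ → ℝ) :
    ∃ K : ℕ → ℝ, ∀ g, SymbolBound B g → ∀ Y : ℝ, 1 ≤ Y → ∀ y : Fin m → ℝ,
      (∀ j, Y ≤ |y j|) → ∃ h : ℝ → ℝ, ContDiff ℝ (⊤ : ℕ∞) h ∧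
        (∀ k u, |iteratedDeriv k h u - iteratedDeriv k g u| * Y ≤ K k * (1 + |u|)) ∧
        ∀ (n : ℕ) (_ : 1 ≤ n) (x : Fin n → ℝ),
          (∏ j, -y j) * divDiff g (Fin.append x y) = divDiff h x := by
  induction m generalizing B with
  | zero =>
    refine ⟨0, fun g hg Y _ y _ => ⟨g, hg.smooth, by simp, fun n hn x => ?_⟩⟩
    rw [Subsingleton.elim y Fin.elim0, Fin.append_elim0]
    simp
  | succ m ih =>
    obtain ⟨B', K, hK⟩ := exists_symbolBound_diffQuot B
    obtain ⟨K', hK'⟩ := ih B'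
    refine ⟨K' + K, fun g hg Y hY y hy => ?_⟩
    have ha := hy (Fin.last m)
    obtain ⟨hb, hclose⟩ := hK g hg (y (Fin.last m)) (hY.trans ha)
    obtain ⟨h, hh, hclose', hdiv⟩ := hK' _ hb Y hY (Fin.init y) fun j => hy j.castSucc
    refine ⟨h, hh, fun k u => ?_, fun n hn x => ?_⟩
    · have h1 := hclose k u
      have h2 := hclose' k u
      set d := iteratedDeriv k (fun v => -y (Fin.last m) * diffQuot (y (Fin.last m)) g v) u
      have h3 := abs_sub_le (iteratedDeriv k h u) d (iteratedDeriv k g u)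
      have h4 : |d - iteratedDeriv k g u| * Y ≤ |d - iteratedDeriv k g u| * |y (Fin.last m)| := by
        gcongr
      have h5 := mul_le_mul_of_nonneg_right h3 (by linarith : 0 ≤ Y)
      simp only [Pi.add_apply]
      linarith
    · rw [← hdiv n hn x, divDiff_const_mul, Fin.prod_univ_castSucc]
      conv_lhs => rw [← Fin.snoc_init_self y, Fin.append_snoc]
      have := divDiff_snoc hg.smooth (n := n + m) (by omega) (Fin.append x (Fin.init y))
        (y (Fin.last m))
      simp only [Fin.snoc_castSucc, Fin.snoc_last]
      rw [mul_assoc]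
      exact congrArg₂ _ rfl (congrArg _ this)

lemma abs_divDiff_sub_le {n : ℕ} (x : Fin n → ℝ) (K : ℕ → ℝ) :
    ∃ C : ℝ, ∀ g h : ℝ → ℝ, ContDiff ℝ (⊤ : ℕ∞) g → ContDiff ℝ (⊤ : ℕ∞) h → ∀ δ : ℝ,
      (∀ k u, |iteratedDeriv k h u - iteratedDeriv k g u| ≤ δ * (K k * (1 + |u|))) →
        |divDiff h x - divDiff g x| ≤ δ * C := by
  cases n with
  | zero => exact ⟨0, by simp [divDiff]⟩
  | succ l =>
    set L : (Fin l → ℝ) → ℝ := fun t =>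
      x (Fin.last l) + ∑ j : Fin l, (x j.castSucc - x j.succ) * t j
    have hLc : Continuous L := by fun_prop
    have hΔ := isCompact_monotone_unit l
    refine ⟨∫ t in {t : Fin l → ℝ | Monotone t ∧ ∀ j, t j ∈ Set.Icc (0 : ℝ) 1},
      K l * (1 + |L t|), fun g h hg hh δ hδ => ?_⟩
    have hgi := ((continuous_iteratedDeriv_of_smooth hg l).comp hLc).continuousOn
      |>.integrableOn_compact (μ := volume) hΔ
    have hhi := ((continuous_iteratedDeriv_of_smooth hh l).comp hLc).continuousOn
      |>.integrableOn_compact (μ := volume) hΔ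
    have hKi : Continuous fun t => K l * (1 + |L t|) := by fun_prop
    simp only [divDiff]
    change |(∫ t in _, (iteratedDeriv l h ∘ L) t) - ∫ t in _, (iteratedDeriv l g ∘ L) t| ≤ _
    rw [← integral_const_mul, ← integral_sub hhi hgi, ← Real.norm_eq_abs]
    exact norm_integral_le_of_norm_le ((hKi.continuousOn.integrableOn_compact hΔ).const_mul δ)
      (.of_forall fun t => hδ l (L t))

lemma PreciseOrder.exists_symbolBound {p : ℝ} (hp : 0 ≤ p) {g : ℝ → ℝ}
    (hg : ContDiff ℝ (⊤ : ℕ∞) g) (hord : PreciseOrder g (-p - 1)) :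
    ∃ B, SymbolBound B g := by
  have key : ∀ k : ℕ, ∃ C : ℝ, ∀ x : ℝ, |iteratedDeriv k g x| * (1 + |x|) ^ (k + 1) ≤ C := by
    intro k
    obtain ⟨R, c₁, c₂, -, -, hc₂, h⟩ := hord k
    have hcont : Continuous fun x => |iteratedDeriv k g x| * (1 + |x|) ^ (k + 1) := by
      have := continuous_iteratedDeriv_of_smooth hg k
      fun_prop
    obtain ⟨C, hC⟩ := (isCompact_closedBall (0 : ℝ) (max R 1)).exists_bound_of_continuousOn
      hcont.continuousOn
    refine ⟨max C (c₂ * 2 ^ (k + 1)), fun x => ?_⟩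
    by_cases hx : |x| ≤ max R 1
    · exact (le_abs_self _).trans ((hC x (by simpa using hx)).trans (le_max_left _ _))
    · push Not at hx
      have hR : R < |x| := (le_max_left _ _).trans_lt hx
      have h1 : 1 < |x| := (le_max_right _ _).trans_lt hx
      have hx0 : 0 < |x| := by linarith
      refine le_trans ?_ (le_max_right _ _)
      have h2 : |x| ^ (-p - 1 - (k : ℝ)) ≤ (|x| ^ (k + 1))⁻¹ := by
        rw [← Real.rpow_natCast, ← Real.rpow_neg hx0.le]
        refine Real.rpow_le_rpow_of_exponent_le h1.le ?_
        push_cast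
        linarith
      calc _ ≤ (c₂ * (|x| ^ (k + 1))⁻¹) * (2 * |x|) ^ (k + 1) := by
            gcongr
            · exact (h x hR).2.trans (by gcongr)
            · linarith
        _ = c₂ * 2 ^ (k + 1) := by
            rw [mul_pow]
            field_simp
  choose B hB using key
  exact ⟨B, hg, hB⟩

/-- if `f'` has precise order `−p−1` (`p ≥ 0`), then for all
`n, m ≥ 1` and `x_1,…,x_n ∈ ℝ`, the weighted divided difference
`f'{x_1,…,x_n,y_1,…,y_m}` converges to `f'{x_1,…,x_n}` as `min_j |y_j| → ∞`. -/
theorem statement12 (p : ℝ) (hp : 0 ≤ p) (f : ℝ → ℝ) (hf : ContDiff ℝ (⊤ : ℕ∞) f)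
    (hord : PreciseOrder (deriv f) (-p - 1)) (n m : ℕ) (hn : 1 ≤ n) (hm : 1 ≤ m)
    (x : Fin n → ℝ) :
    ∀ ε : ℝ, 0 < ε → ∃ Y : ℝ, 0 < Y ∧
      ∀ y : Fin m → ℝ, (∀ j, Y < |y j|) →
        |wDivDiff f (Fin.append x y) - wDivDiff f x| < ε := by
  intro ε hε
  have hg : ContDiff ℝ (⊤ : ℕ∞) (deriv f) := (contDiff_infty_iff_deriv.1 hf).2
  obtain ⟨B, hB⟩ := hord.exists_symbolBound hp hg
  obtain ⟨K, hK⟩ := exists_absorb_far_points m B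
  obtain ⟨C, hC⟩ := abs_divDiff_sub_le x K
  set P := |∏ j, x j|
  have hP0 : 0 ≤ P := abs_nonneg _
  set Y := 1 + P * |C| / ε with hY
  have hY1 : 1 ≤ Y := by
    have : 0 ≤ P * |C| / ε := by positivity
    linarith
  have hY0 : 0 < Y := by linarith
  refine ⟨Y, hY0, fun y hy => ?_⟩
  obtain ⟨h, hh, hclose, hdiv⟩ := hK _ hB Y hY1 y fun j => (hy j).le
  have hle := hC (deriv f) h hg hh Y⁻¹ fun k u => by
    rw [inv_mul_eq_div, le_div_iff₀ hY0]
    exact hclose k u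
  have heq : wDivDiff f (Fin.append x y) = (-1 : ℝ) ^ n * (∏ j, x j) * divDiff h x := by
    rw [← hdiv n hn x, wDivDiff, Fin.prod_univ_add, Finset.prod_neg]
    simp only [Fin.append_left, Fin.append_right, Finset.card_univ, Fintype.card_fin]
    ring
  rw [heq, wDivDiff, ← mul_sub, abs_mul, abs_mul, abs_pow, abs_neg, abs_one, one_pow, one_mul]
  calc P * |divDiff h x - divDiff (deriv f) x| ≤ P * (Y⁻¹ * |C|) := by
        gcongr
        exact hle.trans (by gcongr; exact le_abs_self C)
    _ = P * |C| / Y := by ring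
    _ < ε := by
      rw [div_lt_iff₀ hY0, hY, mul_add, mul_div_cancel₀ _ hε.ne']
      linarith
end

section
/- Let p ∈ ℝ_{≥0} and let f ∈ C^∞(ℝ) be such that f' is of precise order −p−1. For all n ≥ 1, all x_1, …, x_n ∈ ℝ satisfying f'{x_1, …, x_n} ≠ 0, and all m ∈ ℕ, there exist constants C_1, C_2 > 0 and R_x > 0 such that for all y_1, …, y_m ∈ ℝ with |y_j| > R_x for all j, one has C_1 ≤ |f'{x_1, …, x_n, y_1, …, y_m}| ≤ C_2. -/
open MeasureTheory

/-- The ordered simplex `0 ≤ t₀ ≤ ⋯ ≤ t_{m-1} ≤ 1`. -/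
def orderedSimplex (m : ℕ) : Set (Fin m → ℝ) :=
  {t | Monotone t ∧ ∀ j, t j ∈ Set.Icc (0 : ℝ) 1}

/-- The affine parametrization of the convex hull of the points `x` by the ordered simplex. -/
def hullPoint {m : ℕ} (x : Fin (m + 1) → ℝ) (t : Fin m → ℝ) : ℝ :=
  x (Fin.last m) + ∑ j : Fin m, (x j.castSucc - x j.succ) * t j

lemma divDiff_succ (g : ℝ → ℝ) {m : ℕ} (x : Fin (m + 1) → ℝ) :
    divDiff g x = ∫ t in orderedSimplex m, iteratedDeriv m g (hullPoint x t) := rfl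

lemma continuous_hullPoint {m : ℕ} (x : Fin (m + 1) → ℝ) : Continuous (hullPoint x) := by
  unfold hullPoint
  fun_prop

lemma orderedSimplex_subset_Icc (m : ℕ) : orderedSimplex m ⊆ Set.Icc 0 1 :=
  fun _ ht => ⟨fun j => (ht.2 j).1, fun j => (ht.2 j).2⟩

lemma isCompact_orderedSimplex (m : ℕ) : IsCompact (orderedSimplex m) := by
  refine isCompact_Icc.of_isClosed_subset ?_ (orderedSimplex_subset_Icc m)
  have h : orderedSimplex m =
      (⋂ i, ⋂ j, ⋂ (_ : i ≤ j), {t : Fin m → ℝ | t i ≤ t j}) ∩ Set.Icc 0 1 := by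
    ext t
    simp only [orderedSimplex, Set.mem_ofPred_eq, Set.mem_inter_iff, Set.mem_iInter, Set.mem_Icc,
      Pi.le_def, Pi.zero_apply, Pi.one_apply, forall_and]
    rfl
  rw [h]
  exact (isClosed_iInter fun i => isClosed_iInter fun j => isClosed_iInter fun _ =>
    isClosed_le (continuous_apply i) (continuous_apply j)).inter isClosed_Icc

lemma volume_orderedSimplex_le_one (m : ℕ) : volume.real (orderedSimplex m) ≤ 1 := by
  have h : volume.real (Set.Icc (0 : Fin m → ℝ) 1) = 1 := by
    simp [Measure.real, Real.volume_Icc_pi]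
  exact (measureReal_mono (orderedSimplex_subset_Icc m) isCompact_Icc.measure_lt_top.ne).trans h.le

/-- The lower end of the range of a coordinate inserted at position `k`. -/
def insertLower {m : ℕ} (k : Fin (m + 1)) (u : Fin m → ℝ) : ℝ :=
  Fin.cases (motive := fun _ => ℝ) 0 u k

/-- The upper end of the range of a coordinate inserted at position `k`. -/
def insertUpper {m : ℕ} (k : Fin (m + 1)) (u : Fin m → ℝ) : ℝ :=
  Fin.lastCases (motive := fun _ => ℝ) 1 u k

lemma insertLower_le_insertUpper {m : ℕ} (k : Fin (m + 1)) {u : Fin m → ℝ}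
    (hu : u ∈ orderedSimplex m) : insertLower k u ≤ insertUpper k u := by
  unfold insertLower insertUpper
  cases k using Fin.lastCases with
  | last =>
    rw [Fin.lastCases_last]
    cases m with
    | zero => exact zero_le_one
    | succ m => exact (hu.2 (Fin.last m)).2
  | cast k =>
    rw [Fin.lastCases_castSucc]
    cases m with
    | zero => exact k.elim0
    | succ m =>
      cases k using Fin.cases with
      | zero => exact (hu.2 0).1
      | succ k => exact hu.1 (Fin.castSucc_le_succ k)

lemma insertNth_mem_orderedSimplex_iff {m : ℕ} (k : Fin (m + 1)) (τ : ℝ) (u : Fin m → ℝ) :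
    (k.insertNth τ u : Fin (m + 1) → ℝ) ∈ orderedSimplex (m + 1) ↔
      u ∈ orderedSimplex m ∧ τ ∈ Set.Icc (insertLower k u) (insertUpper k u) := by
  constructor
  · rintro ⟨hmono, hmem⟩
    refine ⟨⟨fun i j hij => ?_, fun j => ?_⟩, ?_, ?_⟩
    · simpa using hmono ((Fin.strictMono_succAbove k).monotone hij)
    · simpa using hmem (k.succAbove j)
    · cases k using Fin.cases with
      | zero => simpa [insertLower] using (hmem 0).1
      | succ k =>
        have h := hmono (Fin.castSucc_le_succ k)
        rw [← Fin.succAbove_succ_self k, Fin.insertNth_apply_succAbove,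
          Fin.insertNth_apply_same] at h
        exact h
    · cases k using Fin.lastCases with
      | last => simpa [insertUpper] using (hmem (Fin.last m)).2
      | cast k =>
        have h := hmono (Fin.castSucc_le_succ k)
        rw [← Fin.succAbove_castSucc_self k, Fin.insertNth_apply_succAbove,
          Fin.insertNth_apply_same] at h
        simpa [insertUpper] using h
  · rintro ⟨hu, hlo, hhi⟩
    have hlo' : ∀ i : Fin m, i.castSucc < k → u i ≤ τ := by
      intro i hi
      refine le_trans ?_ hlo
      cases k using Fin.cases with
      | zero => simp at hi
      | succ k => exact hu.1 (Fin.castSucc_lt_succ_iff.1 hi)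
    have hhi' : ∀ i : Fin m, k ≤ i.castSucc → τ ≤ u i := by
      intro i hi
      refine hhi.trans ?_
      cases k using Fin.lastCases with
      | last => exact absurd hi (not_le.2 (Fin.castSucc_lt_last i))
      | cast k =>
        simp only [insertUpper, Fin.lastCases_castSucc]
        exact hu.1 (Fin.castSucc_le_castSucc_iff.1 hi)
    refine ⟨fun i j hij => ?_, fun j => ?_⟩
    · cases i using Fin.succAboveCases k with
      | x =>
        cases j using Fin.succAboveCases k with
        | x => exact le_rfl
        | p j =>
          simp only [Fin.insertNth_apply_same, Fin.insertNth_apply_succAbove]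
          refine hhi' j (not_lt.1 fun h => ?_)
          rw [Fin.succAbove_of_castSucc_lt _ _ h] at hij
          exact absurd h (not_lt.2 hij)
      | p i =>
        cases j using Fin.succAboveCases k with
        | x =>
          simp only [Fin.insertNth_apply_same, Fin.insertNth_apply_succAbove]
          refine hlo' i (not_le.1 fun h => ?_)
          rw [Fin.succAbove_of_le_castSucc _ _ h] at hij
          exact absurd (hij.trans h) (not_le.2 (Fin.castSucc_lt_succ))
        | p j =>
          simp only [Fin.insertNth_apply_succAbove]
          exact hu.1 (Fin.succAbove_le_succAbove_iff.1 hij)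
    · cases j using Fin.succAboveCases k with
      | x =>
        rw [Fin.insertNth_apply_same]
        constructor
        · refine le_trans ?_ hlo
          cases k using Fin.cases with
          | zero => exact le_rfl
          | succ k => exact (hu.2 k).1
        · refine hhi.trans ?_
          unfold insertUpper
          cases k using Fin.lastCases with
          | last => rw [Fin.lastCases_last]
          | cast k => rw [Fin.lastCases_castSucc]; exact (hu.2 k).2
      | p j => simpa using hu.2 j

lemma hullPoint_insertNth {m : ℕ} (x : Fin (m + 2) → ℝ) (k : Fin (m + 1)) (τ : ℝ)
    (u : Fin m → ℝ) :
    hullPoint x (k.insertNth τ u) = hullPoint x (k.insertNth 0 u) +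
      (x k.castSucc - x k.succ) * τ := by
  simp only [hullPoint, Fin.sum_univ_succAbove _ k, Fin.insertNth_apply_same,
    Fin.insertNth_apply_succAbove]
  ring

lemma hullPoint_insertNth_insertUpper {m : ℕ} (x : Fin (m + 2) → ℝ) (k : Fin (m + 1))
    (u : Fin m → ℝ) :
    hullPoint x (k.insertNth (insertUpper k u) u) = hullPoint (x ∘ k.succ.succAbove) u := by
  simp only [hullPoint, Fin.sum_univ_succAbove _ k, Fin.insertNth_apply_same,
    Fin.insertNth_apply_succAbove, Function.comp_apply]
  cases k using Fin.lastCases with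
  | last =>
    simp [insertUpper]
    ring
  | cast k =>
    have hlast : k.castSucc.succ.succAbove (Fin.last m) = Fin.last (m + 1) := by
      rw [Fin.succAbove_of_le_castSucc _ _ (by simp [Fin.le_def]), Fin.succ_last]
    simp only [insertUpper, Fin.lastCases_castSucc, hlast, add_right_inj]
    rw [← Finset.add_sum_erase _ _ (Finset.mem_univ k),
      ← Finset.add_sum_erase (a := k) _ _ (Finset.mem_univ k), ← add_assoc]
    congr 1
    · have h1 : k.castSucc.succ.succAbove k.castSucc = k.castSucc.castSucc :=
        Fin.succAbove_of_castSucc_lt _ _ (by simp [Fin.lt_def])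
      have h2 : k.castSucc.succ.succAbove k.succ = k.succ.succ :=
        Fin.succAbove_of_le_castSucc _ _ (by simp)
      rw [h1, h2, Fin.succAbove_castSucc_self, ← Fin.succ_castSucc]
      ring
    · refine Finset.sum_congr rfl fun i hi => ?_
      have hne : i ≠ k := Finset.ne_of_mem_erase hi
      have h1 : k.castSucc.succ.succAbove i.castSucc = (k.castSucc.succAbove i).castSucc := by
        have := Fin.val_ne_of_ne hne
        ext
        simp only [Fin.succAbove, Fin.lt_def]
        split_ifs <;> simp_all <;> omega
      have h2 : k.castSucc.succ.succAbove i.succ = (k.castSucc.succAbove i).succ := by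
        rw [Fin.succ_succAbove_succ]
      rw [h1, h2]

lemma hullPoint_insertNth_insertLower {m : ℕ} (x : Fin (m + 2) → ℝ) (k : Fin (m + 1))
    (u : Fin m → ℝ) :
    hullPoint x (k.insertNth (insertLower k u) u) = hullPoint (x ∘ k.castSucc.succAbove) u := by
  have hlast : k.castSucc.succAbove (Fin.last m) = Fin.last (m + 1) := by
    rw [Fin.succAbove_of_le_castSucc _ _ (by simp [Fin.le_def]; omega), Fin.succ_last]
  simp only [hullPoint, Fin.sum_univ_succAbove _ k, Fin.insertNth_apply_same,
    Fin.insertNth_apply_succAbove, Function.comp_apply, hlast, add_right_inj]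
  cases k using Fin.cases with
  | zero => simp [insertLower]
  | succ k =>
    simp only [insertLower, Fin.cases_succ]
    rw [← Finset.add_sum_erase _ _ (Finset.mem_univ k),
      ← Finset.add_sum_erase (a := k) _ _ (Finset.mem_univ k), ← add_assoc]
    congr 1
    · have h1 : k.succ.castSucc.succAbove k.castSucc = k.castSucc.castSucc :=
        Fin.succAbove_of_castSucc_lt _ _ (by simp [Fin.lt_def])
      have h2 : k.succ.castSucc.succAbove k.succ = k.succ.succ :=
        Fin.succAbove_of_le_castSucc _ _ (by simp)
      rw [h1, h2, Fin.succAbove_succ_self, ← Fin.succ_castSucc]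
      ring
    · refine Finset.sum_congr rfl fun i hi => ?_
      have hne : i ≠ k := Finset.ne_of_mem_erase hi
      have h1 : k.succ.castSucc.succAbove i.castSucc = (k.succ.succAbove i).castSucc := by
        rw [Fin.castSucc_succAbove_castSucc]
      have h2 : k.succ.castSucc.succAbove i.succ = (k.succ.succAbove i).succ := by
        have := Fin.val_ne_of_ne hne
        ext
        simp only [Fin.succAbove, Fin.lt_def]
        split_ifs <;> simp_all <;> omega
      rw [h1, h2]

lemma setIntegral_orderedSimplex_succ {m : ℕ} (k : Fin (m + 1)) {F : (Fin (m + 1) → ℝ) → ℝ}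
    (hF : Continuous F) :
    ∫ t in orderedSimplex (m + 1), F t =
      ∫ u in orderedSimplex m, ∫ τ in insertLower k u..insertUpper k u, F (k.insertNth τ u) := by
  have hmeas := (isCompact_orderedSimplex (m + 1)).measurableSet
  have hint : Integrable ((orderedSimplex (m + 1)).indicator F) :=
    (integrable_indicator_iff hmeas).2
      (hF.continuousOn.integrableOn_compact (isCompact_orderedSimplex (m + 1)))
  have hmp := (volume_preserving_piFinSuccAbove (fun _ : Fin (m + 1) => ℝ) k).symm
  rw [← integral_indicator hmeas, ← hmp.integral_comp',
    Measure.volume_eq_prod, integral_prod_symm,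
    ← integral_indicator (isCompact_orderedSimplex m).measurableSet]
  · refine integral_congr_ae (Filter.Eventually.of_forall fun u => ?_)
    change (∫ τ : ℝ, (orderedSimplex (m + 1)).indicator F (k.insertNth τ u)) = _
    by_cases hu : u ∈ orderedSimplex m
    · rw [Set.indicator_of_mem hu,
        intervalIntegral.integral_of_le (insertLower_le_insertUpper k hu),
        ← integral_Icc_eq_integral_Ioc, ← integral_indicator measurableSet_Icc]
      refine integral_congr_ae (Filter.Eventually.of_forall fun τ => ?_)
      beta_reduce
      by_cases hτ : τ ∈ Set.Icc (insertLower k u) (insertUpper k u)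
      · rw [Set.indicator_of_mem hτ,
          Set.indicator_of_mem ((insertNth_mem_orderedSimplex_iff k τ u).2 ⟨hu, hτ⟩)]
      · rw [Set.indicator_of_notMem hτ,
          Set.indicator_of_notMem fun h => hτ ((insertNth_mem_orderedSimplex_iff k τ u).1 h).2]
    · rw [Set.indicator_of_notMem hu]
      refine integral_eq_zero_of_ae (Filter.Eventually.of_forall fun τ => ?_)
      exact Set.indicator_of_notMem
        (fun h => hu ((insertNth_mem_orderedSimplex_iff k τ u).1 h).1) F
  · exact (hmp.integrable_comp_emb (MeasurableEquiv.measurableEmbedding _)).2 hint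

lemma divDiff_adjacent {g : ℝ → ℝ} (hg : ContDiff ℝ (⊤ : ℕ∞) g) {m : ℕ} (x : Fin (m + 2) → ℝ)
    (k : Fin (m + 1)) :
    (x k.castSucc - x k.succ) * divDiff g x =
      divDiff g (x ∘ k.succ.succAbove) - divDiff g (x ∘ k.castSucc.succAbove) := by
  have hcont (j : ℕ) : Continuous (iteratedDeriv j g) :=
    hg.continuous_iteratedDeriv j (by exact_mod_cast le_top)
  have hderiv (z : ℝ) : HasDerivAt (iteratedDeriv m g) (iteratedDeriv (m + 1) g z) z := by
    rw [iteratedDeriv_succ]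
    exact ((hg.differentiable_iteratedDeriv m (by exact_mod_cast ENat.natCast_lt_top m)) z).hasDerivAt
  have hintegrable (y : Fin (m + 1) → ℝ) :
      IntegrableOn (fun t => iteratedDeriv m g (hullPoint y t)) (orderedSimplex m) :=
    ((hcont m).comp (continuous_hullPoint y)).continuousOn.integrableOn_compact
      (isCompact_orderedSimplex m)
  simp only [divDiff_succ]
  rw [← integral_sub (hintegrable _) (hintegrable _),
    setIntegral_orderedSimplex_succ k (F := fun t => iteratedDeriv (m + 1) g (hullPoint x t))
      ((hcont _).comp (continuous_hullPoint x)),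
    ← integral_const_mul]
  refine integral_congr_ae (Filter.Eventually.of_forall fun u => ?_)
  simp only [← hullPoint_insertNth_insertUpper, ← hullPoint_insertNth_insertLower]
  rw [← intervalIntegral.integral_const_mul]
  have hline : (fun τ => hullPoint x (k.insertNth τ u)) = fun τ =>
      hullPoint x (k.insertNth 0 u) + (x k.castSucc - x k.succ) * τ :=
    funext fun τ => hullPoint_insertNth x k τ u
  refine intervalIntegral.integral_eq_sub_of_hasDerivAt
    (f := fun τ => iteratedDeriv m g (hullPoint x (k.insertNth τ u))) (fun τ _ => ?_) ?_
  · have h : HasDerivAt (fun τ => hullPoint x (k.insertNth τ u)) (x k.castSucc - x k.succ) τ := by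
      rw [hline]
      simpa using ((hasDerivAt_id τ).const_mul (x k.castSucc - x k.succ)).const_add
        (hullPoint x (k.insertNth 0 u))
    rw [mul_comm]
    exact (hderiv _).comp τ h
  · refine Continuous.intervalIntegrable ?_ _ _
    refine continuous_const.mul ((hcont _).comp (f := fun τ => hullPoint x (k.insertNth τ u)) ?_)
    rw [hline]
    fun_prop

/-- The divided-difference recursion with respect to an arbitrary pair of points. -/
lemma sub_mul_divDiff {g : ℝ → ℝ} (hg : ContDiff ℝ (⊤ : ℕ∞) g) {m : ℕ} (x : Fin (m + 2) → ℝ)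
    (i j : Fin (m + 2)) :
    (x i - x j) * divDiff g x = divDiff g (x ∘ j.succAbove) - divDiff g (x ∘ i.succAbove) := by
  have h (i : Fin (m + 2)) : x i * divDiff g x + divDiff g (x ∘ i.succAbove) =
      x 0 * divDiff g x + divDiff g (x ∘ (0 : Fin (m + 2)).succAbove) := by
    induction i using Fin.induction with
    | zero => rfl
    | succ k ih =>
      rw [← ih]
      linarith [divDiff_adjacent hg x k]
  linarith [h i, h j]

lemma abs_hullPoint_sub_le {m : ℕ} (x : Fin (m + 1) → ℝ) {t : Fin m → ℝ}
    (ht : t ∈ orderedSimplex m) {c r : ℝ} (hx : ∀ j, |x j - c| ≤ r) :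
    |hullPoint x t - c| ≤ r := by
  induction m with
  | zero => simpa [hullPoint] using hx (Fin.last 0)
  | succ m ih =>
    obtain ⟨τ, u, rfl⟩ : ∃ τ u, t = (0 : Fin (m + 1)).insertNth (α := fun _ => ℝ) τ u :=
      ⟨t 0, (0 : Fin (m + 1)).removeNth t, (Fin.insertNth_self_removeNth 0 t).symm⟩
    obtain ⟨hu, hτ⟩ := (insertNth_mem_orderedSimplex_iff 0 τ u).1 ht
    have h1 := ih (x ∘ (0 : Fin (m + 1)).castSucc.succAbove) hu fun j => hx _
    have h2 := ih (x ∘ (0 : Fin (m + 1)).succ.succAbove) hu fun j => hx _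
    rw [← hullPoint_insertNth_insertLower, hullPoint_insertNth, abs_le] at h1
    rw [← hullPoint_insertNth_insertUpper, hullPoint_insertNth, abs_le] at h2
    rw [hullPoint_insertNth, abs_le]
    rcases le_total 0 (x (0 : Fin (m + 1)).castSucc - x (0 : Fin (m + 1)).succ) with h | h
    · have := mul_le_mul_of_nonneg_left hτ.1 h
      have := mul_le_mul_of_nonneg_left hτ.2 h
      constructor <;> linarith
    · have := mul_le_mul_of_nonpos_left hτ.1 h
      have := mul_le_mul_of_nonpos_left hτ.2 h
      constructor <;> linarith

lemma abs_divDiff_le {g : ℝ → ℝ} {m : ℕ} (x : Fin (m + 1) → ℝ) {c r M : ℝ}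
    (hx : ∀ j, |x j - c| ≤ r) (hM : ∀ z, |z - c| ≤ r → |iteratedDeriv m g z| ≤ M) :
    |divDiff g x| ≤ M := by
  have hM0 : 0 ≤ M := (abs_nonneg _).trans (hM _ (hx 0))
  rw [divDiff_succ, ← Real.norm_eq_abs]
  refine (norm_setIntegral_le_of_norm_le_const (C := M)
    (isCompact_orderedSimplex m).measure_lt_top fun t ht => ?_).trans ?_
  · exact hM _ (abs_hullPoint_sub_le x ht hx)
  · exact mul_le_of_le_one_right hM0 (volume_orderedSimplex_le_one m)

/-- Symbol estimates of order `-1` for `g` give a product bound for its divided differences. -/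
lemma exists_prod_mul_abs_divDiff_le {g : ℝ → ℝ} (hg : ContDiff ℝ (⊤ : ℕ∞) g)
    (hdecay : ∀ k : ℕ, ∃ C, ∀ z, (1 + |z|) ^ (k + 1) * |iteratedDeriv k g z| ≤ C) (m : ℕ) :
    ∃ C, 0 ≤ C ∧ ∀ x : Fin (m + 1) → ℝ, (∏ j, (1 + |x j|)) * |divDiff g x| ≤ C := by
  have near (m : ℕ) : ∃ C, 0 ≤ C ∧ ∀ (x : Fin (m + 1) → ℝ) (q : Fin (m + 1)),
      (∀ i, |x i| ≤ |x q|) → (∀ i, |x i - x q| ≤ (1 + |x q|) / 2) →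
      (∏ j, (1 + |x j|)) * |divDiff g x| ≤ C := by
    obtain ⟨C, hC⟩ := hdecay m
    have hC0 : 0 ≤ C := le_trans (by positivity) (hC 0)
    refine ⟨2 ^ (m + 1) * C, by positivity, fun x q hq hclose => ?_⟩
    have hpos : 0 < 1 + |x q| := by positivity
    have hbound : |divDiff g x| ≤ C / ((1 + |x q|) / 2) ^ (m + 1) := by
      refine abs_divDiff_le x hclose fun z hz => ?_
      rw [le_div_iff₀ (by positivity), mul_comm]
      refine le_trans ?_ (hC z)
      gcongr
      have := abs_sub_abs_le_abs_sub (x q) z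
      rw [abs_sub_comm] at this
      linarith
    have hprod : ∏ j, (1 + |x j|) ≤ (1 + |x q|) ^ (m + 1) := by
      refine (Finset.prod_le_prod (fun j _ => by positivity)
        fun j _ => add_le_add_right (hq j) 1).trans ?_
      simp
    calc (∏ j, (1 + |x j|)) * |divDiff g x|
        ≤ (1 + |x q|) ^ (m + 1) * (C / ((1 + |x q|) / 2) ^ (m + 1)) := by gcongr
      _ = 2 ^ (m + 1) * C := by
        rw [div_pow]
        field_simp
  induction m with
  | zero =>
    obtain ⟨C, hC0, hC⟩ := near 0
    refine ⟨C, hC0, fun x => hC x 0 (fun i => ?_) fun i => ?_⟩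
    · rw [Fin.fin_one_eq_zero i]
    · rw [Fin.fin_one_eq_zero i, sub_self, abs_zero]
      positivity
  | succ m ih =>
    obtain ⟨C, hC0, hC⟩ := near (m + 1)
    obtain ⟨D, hD0, hD⟩ := ih
    refine ⟨C + 4 * D, by positivity, fun x => ?_⟩
    obtain ⟨q, hq⟩ := Finite.exists_max fun j => |x j|
    by_cases hclose : ∀ i, |x i - x q| ≤ (1 + |x q|) / 2
    · linarith [hC x q hq hclose]
    push Not at hclose
    obtain ⟨i, hi⟩ := hclose
    have hpos : 0 < 1 + |x q| := by positivity
    have hrec : |x i - x q| * |divDiff g x| ≤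
        |divDiff g (x ∘ q.succAbove)| + |divDiff g (x ∘ i.succAbove)| := by
      rw [← abs_mul, sub_mul_divDiff hg]
      exact abs_sub _ _
    have hP (j : Fin (m + 2)) :
        (∏ l, (1 + |x l|)) * |divDiff g (x ∘ j.succAbove)| ≤ (1 + |x q|) * D := by
      rw [Fin.prod_univ_succAbove _ j, mul_assoc]
      exact mul_le_mul (add_le_add_right (hq j) 1) (hD (x ∘ j.succAbove)) (by positivity) hpos.le
    have hP0 : 0 ≤ ∏ l, (1 + |x l|) := Finset.prod_nonneg fun l _ => by positivity
    have h1 : (1 + |x q|) / 2 * |divDiff g x| ≤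
        |divDiff g (x ∘ q.succAbove)| + |divDiff g (x ∘ i.succAbove)| :=
      (mul_le_mul_of_nonneg_right hi.le (abs_nonneg _)).trans hrec
    have h2 := mul_le_mul_of_nonneg_left h1 hP0
    have h3 : (1 + |x q|) * ((∏ l, (1 + |x l|)) * |divDiff g x|) ≤ (1 + |x q|) * (4 * D) := by
      linarith [hP q, hP i]
    linarith [le_of_mul_le_mul_left h3 hpos]

lemma PreciseOrder.exists_pow_mul_abs_iteratedDeriv_le {g : ℝ → ℝ}
    (hg : ContDiff ℝ (⊤ : ℕ∞) g) {p : ℝ} (hp : 0 ≤ p) (hord : PreciseOrder g (-p - 1)) (k : ℕ) :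
    ∃ C, ∀ z, (1 + |z|) ^ (k + 1) * |iteratedDeriv k g z| ≤ C := by
  obtain ⟨R, c₁, c₂, hR, hc₁, hc₂, h⟩ := hord k
  have hcont : Continuous fun z => (1 + |z|) ^ (k + 1) * |iteratedDeriv k g z| := by
    have := hg.continuous_iteratedDeriv k (by exact_mod_cast le_top)
    fun_prop
  obtain ⟨B, hB⟩ := (isCompact_closedBall (0 : ℝ) (max R 1)).bddAbove_image hcont.continuousOn
  refine ⟨max B (2 ^ (k + 1) * c₂), fun z => ?_⟩
  rcases le_or_gt |z| (max R 1) with hz | hz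
  · exact le_max_of_le_left (hB ⟨z, by simpa using hz, rfl⟩)
  · refine le_max_of_le_right ?_
    obtain ⟨hzR, hz1⟩ := max_lt_iff.1 hz
    have hz0 : 0 < |z| := one_pos.trans hz1
    have hpow : |z| ^ (-p - 1 - (k : ℝ)) ≤ (|z| ^ (k + 1))⁻¹ := by
      rw [← Real.rpow_natCast, ← Real.rpow_neg hz0.le]
      refine Real.rpow_le_rpow_of_exponent_le hz1.le ?_
      push_cast
      linarith
    calc (1 + |z|) ^ (k + 1) * |iteratedDeriv k g z|
        ≤ (2 * |z|) ^ (k + 1) * (c₂ * (|z| ^ (k + 1))⁻¹) := by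
          gcongr
          · linarith
          · exact (h z hzR).2.trans (by gcongr)
      _ = 2 ^ (k + 1) * c₂ := by
        rw [mul_pow]
        field_simp

/-- The recursion for weighted divided differences when a point is appended to a tuple. -/
lemma sub_mul_wDivDiff_snoc {f : ℝ → ℝ} (hf : ContDiff ℝ (⊤ : ℕ∞) (deriv f)) {N : ℕ}
    (z : Fin (N + 1) → ℝ) (i : Fin (N + 1)) (η : ℝ) :
    (η - z i) * wDivDiff f (Fin.snoc z η : Fin (N + 2) → ℝ) =
      η * wDivDiff f z - z i * wDivDiff f
        ((Fin.snoc z η : Fin (N + 2) → ℝ) ∘ i.castSucc.succAbove) := by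
  set w : Fin (N + 2) → ℝ := Fin.snoc z η with hw
  have hwi : w i.castSucc = z i := by simp [hw]
  have hwl : w (Fin.last _) = η := by simp [hw]
  have hwz : w ∘ (Fin.last (N + 1)).succAbove = z := by
    ext j
    simp [hw]
  have hrec := sub_mul_divDiff hf w i.castSucc (Fin.last _)
  have hprod₁ : ∏ j, w j = η * ∏ j, z j := by
    rw [Fin.prod_univ_succAbove _ (Fin.last _), hwl, ← hwz]
    rfl
  have hprod₂ : η * ∏ j, z j = z i * ∏ j, (w ∘ i.castSucc.succAbove) j := by
    rw [← hprod₁, Fin.prod_univ_succAbove _ i.castSucc, hwi]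
    rfl
  rw [hwi, hwl, hwz] at hrec
  unfold wDivDiff
  rw [hprod₁]
  linear_combination (-1) ^ (N + 1) * (η * ∏ j, z j) * hrec -
    (-1) ^ (N + 1) * divDiff (deriv f) (w ∘ i.castSucc.succAbove) * hprod₂

lemma abs_wDivDiff_le {f : ℝ → ℝ} {C : ℝ} {m : ℕ}
    (hC : ∀ x : Fin (m + 1) → ℝ, (∏ j, (1 + |x j|)) * |divDiff (deriv f) x| ≤ C)
    (x : Fin (m + 1) → ℝ) : |wDivDiff f x| ≤ C := by
  refine le_trans ?_ (hC x)
  rw [wDivDiff, abs_mul, abs_mul, abs_pow, abs_neg, abs_one, one_pow, one_mul, Finset.abs_prod]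
  gcongr with j
  linarith

lemma abs_mem_Icc_of_sub_mul_eq {a η C C₁ C₂ u v w : ℝ} (hη₁ : 2 * |a| < |η|)
    (hη₂ : |a| * C ≤ C₁ / 2 * |η|) (hu : |u| ≤ C) (hv₁ : C₁ ≤ |v|) (hv₂ : |v| ≤ C₂)
    (h : (η - a) * w = η * v - a * u) :
    C₁ / 3 ≤ |w| ∧ |w| ≤ 2 * C₂ + C₁ := by
  have hη : 0 < |η| := (by positivity : 0 ≤ 2 * |a|).trans_lt hη₁
  have hau : |a * u| ≤ C₁ / 2 * |η| := by
    rw [abs_mul]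
    exact (mul_le_mul_of_nonneg_left hu (abs_nonneg a)).trans hη₂
  have habs : |η - a| * |w| = |η * v - a * u| := by rw [← abs_mul, h]
  have hlow : |η| * |v| - |a * u| ≤ |η - a| * |w| := by
    rw [habs, ← abs_mul]
    exact abs_sub_abs_le_abs_sub _ _
  have hup : |η - a| * |w| ≤ |η| * |v| + |a * u| := by
    rw [habs, ← abs_mul]
    exact abs_sub _ _
  have h1 : |η - a| ≤ 3 / 2 * |η| := by linarith [abs_sub η a]
  have h2 : |η| / 2 ≤ |η - a| := by linarith [abs_sub_abs_le_abs_sub η a]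
  have h3 := mul_le_mul_of_nonneg_right h1 (abs_nonneg w)
  have h4 := mul_le_mul_of_nonneg_right h2 (abs_nonneg w)
  have h5 := mul_le_mul_of_nonneg_left hv₁ hη.le
  have h6 := mul_le_mul_of_nonneg_left hv₂ hη.le
  constructor
  · refine le_of_mul_le_mul_left ?_ hη
    linarith
  · refine le_of_mul_le_mul_left ?_ hη
    linarith

/-- if `f'` has precise order `−p−1` (`p ≥ 0`), `n ≥ 1`,
`f'{x_1,…,x_n} ≠ 0`, and `m ∈ ℕ`, then there are `C₁, C₂, R_x > 0` such that for all
`y_1,…,y_m` with `|y_j| > R_x` one has `C₁ ≤ |f'{x_1,…,x_n,y_1,…,y_m}| ≤ C₂`. -/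
theorem statement13 (p : ℝ) (hp : 0 ≤ p) (f : ℝ → ℝ) (hf : ContDiff ℝ (⊤ : ℕ∞) f)
    (hord : PreciseOrder (deriv f) (-p - 1)) (n : ℕ) (hn : 1 ≤ n)
    (x : Fin n → ℝ) (hx : wDivDiff f x ≠ 0) (m : ℕ) :
    ∃ C₁ C₂ Rx : ℝ, 0 < C₁ ∧ 0 < C₂ ∧ 0 < Rx ∧
      ∀ y : Fin m → ℝ, (∀ j, Rx < |y j|) →
        C₁ ≤ |wDivDiff f (Fin.append x y)| ∧
          |wDivDiff f (Fin.append x y)| ≤ C₂ := by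
  induction m with
  | zero =>
    refine ⟨|wDivDiff f x|, |wDivDiff f x|, 1, abs_pos.2 hx, abs_pos.2 hx, one_pos, fun y _ => ?_⟩
    have h : Fin.append x y = x := by
      rw [Subsingleton.elim y Fin.elim0]
      exact Fin.append_elim0 x
    rw [h]
    exact ⟨le_rfl, le_rfl⟩
  | succ m ih =>
    obtain ⟨C₁, C₂, R, hC₁, hC₂, hR, h⟩ := ih
    have hg : ContDiff ℝ (⊤ : ℕ∞) (deriv f) := (contDiff_infty_iff_deriv.1 hf).2
    obtain ⟨N, hN⟩ : ∃ N, n + m = N + 1 := ⟨n + m - 1, by omega⟩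
    obtain ⟨C, hC0, hC⟩ := exists_prod_mul_abs_divDiff_le hg
      (hord.exists_pow_mul_abs_iteratedDeriv_le hg hp) N
    set a := x ⟨0, hn⟩ with ha
    refine ⟨C₁ / 3, 2 * C₂ + C₁, R + 2 * |a| + 2 * |a| * C / C₁, by positivity, by positivity,
      by positivity, fun y hy => ?_⟩
    have hsplit : Fin.append x y =
        (Fin.snoc (Fin.append x (Fin.init y)) (y (Fin.last m)) : Fin (n + m + 1) → ℝ) := by
      conv_lhs => rw [← Fin.snoc_init_self y]
      exact Fin.append_snoc x (Fin.init y) (y (Fin.last m))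
    have hq : 0 ≤ 2 * |a| * C / C₁ := by positivity
    have hinit := h (Fin.init y) fun j => lt_of_le_of_lt (by linarith [abs_nonneg a]) (hy j.castSucc)
    have hlast := hy (Fin.last m)
    have hai : Fin.append x (Fin.init y) (Fin.castAdd m ⟨0, hn⟩) = a := Fin.append_left _ _ _
    rw [hsplit]
    change C₁ / 3 ≤ |wDivDiff f (n := n + m + 1) _| ∧ |wDivDiff f (n := n + m + 1) _| ≤ _
    generalize Fin.append x (Fin.init y) = z at hinit hai
    generalize Fin.castAdd m ⟨0, hn⟩ = i at hai
    generalize n + m = M at z i hinit hai hN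
    subst hN
    have hη₁ : 2 * |a| < |y (Fin.last m)| := by linarith
    have hη₂ : |a| * C ≤ C₁ / 2 * |y (Fin.last m)| := by
      have : 2 * |a| * C / C₁ ≤ |y (Fin.last m)| := by linarith [abs_nonneg a]
      rw [div_le_iff₀ hC₁] at this
      linarith
    have hrec := sub_mul_wDivDiff_snoc hg z i (y (Fin.last m))
    rw [hai] at hrec
    exact abs_mem_Icc_of_sub_mul_eq hη₁ hη₂ (abs_wDivDiff_le hC _) hinit.1 hinit.2 hrec
end

section
/- Let f ∈ C^∞(ℝ) be such that for every n ∈ ℕ there exists R_n > 0 with f^(n)(x) > 0 for all x < −R_n and (−1)^n f^(n)(x) > 0 for all x > R_n. Let n ≥ 2 and let x_1, …, x_n be real numbers with max_{k ≤ n} R_k < |x_1| ≤ ⋯ ≤ |x_n| such that there exists k ∈ {1, …, n−1} with x_k x_n < 0. Then |f'{x_1, …, x_n}| ≥ (1/2) |f'{x_1, …, x_{n−1}}|. -/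
open MeasureTheory

/-- The simplex `0 ≤ t_1 ≤ ⋯ ≤ t_m ≤ 1`. -/
def orderSimplex (m : ℕ) : Set (Fin m → ℝ) :=
  {t | Monotone t ∧ ∀ j, t j ∈ Set.Icc (0 : ℝ) 1}

theorem isCompact_orderSimplex (m : ℕ) : IsCompact (orderSimplex m) := by
  have h : IsCompact (Set.univ.pi fun _ : Fin m => Set.Icc (0 : ℝ) 1) :=
    isCompact_univ_pi fun _ => isCompact_Icc
  refine h.of_isClosed_subset ?_ fun t ht j _ => ht.2 j
  have : orderSimplex m = (⋂ (a : Fin m) (b : Fin m) (_ : a ≤ b), {t | t a ≤ t b}) ∩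
      ⋂ j : Fin m, {t | t j ∈ Set.Icc (0 : ℝ) 1} := by
    ext t
    simp [orderSimplex, Monotone]
  rw [this]
  refine IsClosed.inter ?_ ?_
  · exact isClosed_iInter fun a => isClosed_iInter fun b => isClosed_iInter fun _ =>
      isClosed_le (continuous_apply a) (continuous_apply b)
  · exact isClosed_iInter fun j => isClosed_Icc.preimage (continuous_apply j)

/-- The upper bound for a new smallest coordinate of a point of the simplex. -/
noncomputable def consBound : {m : ℕ} → (Fin m → ℝ) → ℝ
  | 0, _ => 1
  | _ + 1, t => t 0

theorem continuous_consBound (m : ℕ) : Continuous (consBound : (Fin m → ℝ) → ℝ) := by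
  cases m with
  | zero => exact continuous_const
  | succ m => exact continuous_apply 0

theorem consBound_nonneg {m : ℕ} {t : Fin m → ℝ} (ht : t ∈ orderSimplex m) :
    0 ≤ consBound t := by
  cases m with
  | zero => simp [consBound]
  | succ m => exact (ht.2 0).1

theorem cons_mem_orderSimplex {m : ℕ} (s : ℝ) (t : Fin m → ℝ) :
    (Fin.cons s t : Fin (m + 1) → ℝ) ∈ orderSimplex (m + 1) ↔
      t ∈ orderSimplex m ∧ s ∈ Set.Icc 0 (consBound t) := by
  cases m with
  | zero =>
    simp [orderSimplex, consBound, Fin.forall_fin_one, Subsingleton.monotone]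
  | succ m =>
    simp only [orderSimplex, Set.mem_ofPred_eq, consBound, Fin.monotone_iff_le_succ (n := m + 1),
      Fin.monotone_iff_le_succ (n := m), Fin.forall_fin_succ (n := m), Set.mem_Icc,
      Fin.forall_fin_succ (n := m + 1), Fin.castSucc_zero, Fin.cons_zero, Fin.cons_succ,
      ← Fin.succ_castSucc]
    constructor
    · rintro ⟨⟨h1, h2⟩, ⟨h3, h4⟩, h5, h6⟩
      exact ⟨⟨h2, h5, h6⟩, h3, h1⟩
    · rintro ⟨⟨h2, h5, h6⟩, h3, h1⟩
      exact ⟨⟨h1, h2⟩, ⟨h3, h1.trans h5.2⟩, h5, h6⟩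

theorem setIntegral_orderSimplex_succ {m : ℕ} {h : (Fin (m + 1) → ℝ) → ℝ} (hh : Continuous h) :
    ∫ t in orderSimplex (m + 1), h t =
      ∫ t in orderSimplex m, ∫ s in (0 : ℝ)..consBound t, h (Fin.cons s t) := by
  have hmeas : ∀ k, MeasurableSet (orderSimplex k) := fun k =>
    (isCompact_orderSimplex k).isClosed.measurableSet
  have hint : Integrable ((orderSimplex (m + 1)).indicator h) :=
    (hh.continuousOn.integrableOn_compact (isCompact_orderSimplex _)).integrable_indicator
      (hmeas _)
  have hmp := (volume_preserving_piFinSuccAbove (fun _ : Fin (m + 1) => ℝ) 0).symm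
  rw [← integral_indicator (hmeas _), ← integral_indicator (hmeas _),
    ← hmp.integral_comp' ((orderSimplex (m + 1)).indicator h), Measure.volume_eq_prod,
    integral_prod_symm (fun z => (orderSimplex (m + 1)).indicator h
      ((MeasurableEquiv.piFinSuccAbove (fun _ : Fin (m + 1) => ℝ) 0).symm z))
      ((hmp.integrable_comp_emb (MeasurableEquiv.measurableEmbedding _)).2 hint)]
  refine integral_congr_ae (Filter.Eventually.of_forall fun t => ?_)
  have hcons : ∀ s : ℝ, (MeasurableEquiv.piFinSuccAbove (fun _ : Fin (m + 1) => ℝ) 0).symm (s, t) =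
      Fin.cons s t := by
    intro s
    simp [MeasurableEquiv.piFinSuccAbove_symm_apply, Fin.insertNthEquiv]
  simp only [hcons]
  by_cases ht : t ∈ orderSimplex m
  · rw [Set.indicator_of_mem ht, intervalIntegral.integral_of_le (consBound_nonneg ht),
      ← integral_Icc_eq_integral_Ioc, ← integral_indicator measurableSet_Icc]
    refine integral_congr_ae (Filter.Eventually.of_forall fun s => ?_)
    by_cases hs : s ∈ Set.Icc 0 (consBound t)
    · simp [Set.indicator, cons_mem_orderSimplex, ht, hs]
    · simp only [Set.indicator, cons_mem_orderSimplex, ht, hs, and_false, if_false]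
  · simp [Set.indicator, cons_mem_orderSimplex, ht]

/-- The argument of the derivative in the integral formula for divided differences. -/
noncomputable def simplexPoint {m : ℕ} (x : Fin (m + 1) → ℝ) (t : Fin m → ℝ) : ℝ :=
  x (Fin.last m) + ∑ j : Fin m, (x j.castSucc - x j.succ) * t j

theorem divDiff_eq_setIntegral (f : ℝ → ℝ) {m : ℕ} (x : Fin (m + 1) → ℝ) :
    divDiff f x = ∫ t in orderSimplex m, iteratedDeriv m f (simplexPoint x t) := rfl

theorem continuous_simplexPoint (m : ℕ) :
    Continuous fun p : (Fin (m + 1) → ℝ) × (Fin m → ℝ) => simplexPoint p.1 p.2 := by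
  unfold simplexPoint
  fun_prop

theorem simplexPoint_cons {m : ℕ} (x : Fin (m + 2) → ℝ) (s : ℝ) (t : Fin m → ℝ) :
    simplexPoint x (Fin.cons s t) =
      simplexPoint (x ∘ Fin.succAbove 0) t + (x 0 - x 1) * s := by
  simp only [simplexPoint, Fin.sum_univ_succ, Fin.cons_zero, Fin.cons_succ, Fin.castSucc_zero,
    Fin.succ_zero_eq_one, Function.comp_apply, Fin.succAbove_zero, Fin.succ_last,
    Fin.succ_castSucc]
  ring

theorem simplexPoint_cons_consBound {m : ℕ} (x : Fin (m + 2) → ℝ) (t : Fin m → ℝ) :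
    simplexPoint x (Fin.cons (consBound t) t) = simplexPoint (x ∘ Fin.succAbove 1) t := by
  rw [simplexPoint_cons]
  cases m with
  | zero => simp [simplexPoint, consBound]
  | succ m =>
    have h1 : ∀ j : Fin (m + 1), (1 : Fin (m + 3)).succAbove j.succ = j.succ.succ := by
      intro j
      exact Fin.succAbove_of_le_castSucc _ _ (by simp [Fin.le_def])
    have h0 : (1 : Fin (m + 3)).succAbove 0 = 0 := rfl
    have hl : Fin.last (m + 1) = (Fin.last m).succ := rfl
    simp only [simplexPoint, consBound, Function.comp_apply, Fin.sum_univ_succ,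
      Fin.castSucc_zero, h0, h1, hl, Fin.succAbove_zero, ← Fin.succ_castSucc,
      Fin.succ_zero_eq_one]
    ring

theorem continuous_iteratedDeriv_simplexPoint {f : ℝ → ℝ} (hf : ContDiff ℝ (⊤ : ℕ∞) f) (k m : ℕ) :
    Continuous fun p : (Fin (m + 1) → ℝ) × (Fin m → ℝ) =>
      iteratedDeriv k f (simplexPoint p.1 p.2) :=
  (hf.continuous_iteratedDeriv k (by exact_mod_cast le_top)).comp (continuous_simplexPoint m)

theorem continuous_divDiff {f : ℝ → ℝ} (hf : ContDiff ℝ (⊤ : ℕ∞) f) (m : ℕ) :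
    Continuous fun x : Fin (m + 1) → ℝ => divDiff f x :=
  continuous_parametric_integral_of_continuous
    (continuous_iteratedDeriv_simplexPoint hf m m) (isCompact_orderSimplex m)

theorem divDiff_recurrence_zero_one {f : ℝ → ℝ} (hf : ContDiff ℝ (⊤ : ℕ∞) f) {m : ℕ}
    (x : Fin (m + 2) → ℝ) :
    (x 0 - x 1) * divDiff f x =
      divDiff f (x ∘ Fin.succAbove 1) - divDiff f (x ∘ Fin.succAbove 0) := by
  have hcont : ∀ {k l : ℕ} (y : Fin (l + 1) → ℝ),
      Continuous fun t : Fin l → ℝ => iteratedDeriv k f (simplexPoint y t) := fun y =>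
    (continuous_iteratedDeriv_simplexPoint hf _ _).comp (Continuous.prodMk_right y)
  have hint : ∀ y : Fin (m + 1) → ℝ,
      IntegrableOn (fun t => iteratedDeriv m f (simplexPoint y t)) (orderSimplex m) := fun y =>
    (hcont y).continuousOn.integrableOn_compact (isCompact_orderSimplex m)
  simp only [divDiff_eq_setIntegral]
  rw [setIntegral_orderSimplex_succ (hcont x), ← integral_const_mul,
    ← integral_sub (hint _) (hint _)]
  refine integral_congr_ae (Filter.Eventually.of_forall fun t => ?_)
  simp only [← simplexPoint_cons_consBound, simplexPoint_cons]
  rw [← intervalIntegral.integral_const_mul]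
  have hderiv : ∀ s : ℝ, HasDerivAt
      (fun s => iteratedDeriv m f (simplexPoint (x ∘ Fin.succAbove 0) t + (x 0 - x 1) * s))
      ((x 0 - x 1) *
        iteratedDeriv (m + 1) f (simplexPoint (x ∘ Fin.succAbove 0) t + (x 0 - x 1) * s)) s := by
    intro s
    have h1 : HasDerivAt (fun s => simplexPoint (x ∘ Fin.succAbove 0) t + (x 0 - x 1) * s)
        (x 0 - x 1) s := by
      simpa using ((hasDerivAt_id s).const_mul (x 0 - x 1)).const_add
        (simplexPoint (x ∘ Fin.succAbove 0) t)
    have h2 := (hf.differentiable_iteratedDeriv m (by exact_mod_cast ENat.natCast_lt_top m)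
      (simplexPoint (x ∘ Fin.succAbove 0) t + (x 0 - x 1) * s)).hasDerivAt
    rw [← iteratedDeriv_succ] at h2
    rw [mul_comm (x 0 - x 1) (iteratedDeriv _ _ _)]
    exact h2.comp s h1
  have hc : Continuous (iteratedDeriv (m + 1) f) :=
    hf.continuous_iteratedDeriv _ (by exact_mod_cast le_top)
  rw [intervalIntegral.integral_eq_sub_of_hasDerivAt (fun s _ => hderiv s)
    (Continuous.intervalIntegrable (by fun_prop) _ _)]
  simp

/-- The sum formula for the divided difference at distinct points. -/
noncomputable def lagrangeSum (f : ℝ → ℝ) {n : ℕ} (x : Fin n → ℝ) : ℝ :=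
  ∑ a, f (x a) * (∏ c, if c = a then 1 else x a - x c)⁻¹

theorem lagrangeSum_succAbove (f : ℝ → ℝ) {n : ℕ} {x : Fin (n + 1) → ℝ}
    (hx : Function.Injective x) (j : Fin (n + 1)) :
    lagrangeSum f (x ∘ j.succAbove) =
      ∑ a, f (x a) * (∏ c, if c = a then 1 else x a - x c)⁻¹ * (x a - x j) := by
  rw [Fin.sum_univ_succAbove _ j, sub_self, mul_zero, zero_add, lagrangeSum]
  refine Finset.sum_congr rfl fun a _ => ?_
  rw [Fin.prod_univ_succAbove _ j, if_neg (Fin.succAbove_ne j a).symm]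
  have hne : x (j.succAbove a) - x j ≠ 0 :=
    sub_ne_zero.2 (hx.ne (Fin.succAbove_ne j a))
  simp only [Function.comp_apply, Fin.succAbove_right_inj]
  field_simp

theorem lagrangeSum_recurrence (f : ℝ → ℝ) {n : ℕ} {x : Fin (n + 1) → ℝ}
    (hx : Function.Injective x) (i j : Fin (n + 1)) :
    (x i - x j) * lagrangeSum f x =
      lagrangeSum f (x ∘ j.succAbove) - lagrangeSum f (x ∘ i.succAbove) := by
  rw [lagrangeSum_succAbove f hx, lagrangeSum_succAbove f hx, ← Finset.sum_sub_distrib,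
    lagrangeSum, Finset.mul_sum]
  refine Finset.sum_congr rfl fun a _ => ?_
  ring

theorem divDiff_eq_lagrangeSum {f : ℝ → ℝ} (hf : ContDiff ℝ (⊤ : ℕ∞) f) {m : ℕ}
    {x : Fin (m + 1) → ℝ} (hx : Function.Injective x) : divDiff f x = lagrangeSum f x := by
  induction m with
  | zero =>
    have : orderSimplex 0 = Set.univ := by
      ext t
      simp [orderSimplex, Subsingleton.monotone]
    simp [divDiff_eq_setIntegral, this, simplexPoint, lagrangeSum, Measure.real, volume_pi]
  | succ m ih =>
    have hne : x 0 - x 1 ≠ 0 := sub_ne_zero.2 (hx.ne (by simp))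
    refine mul_left_cancel₀ hne ?_
    rw [divDiff_recurrence_zero_one hf, lagrangeSum_recurrence f hx,
      ih (hx.comp Fin.succAbove_right_injective), ih (hx.comp Fin.succAbove_right_injective)]

theorem dense_injective (n : ℕ) : Dense {x : Fin n → ℝ | Function.Injective x} := by
  have h : {x : Fin n → ℝ | Function.Injective x} =
      ⋂ p : {p : Fin n × Fin n // p.1 ≠ p.2}, {x | x p.1.1 ≠ x p.1.2} := by
    ext x
    simp only [Set.mem_ofPred_eq, Set.mem_iInter, Subtype.forall, Prod.forall]
    exact ⟨fun hx a b hab => hx.ne hab, fun hx a b hab => by_contra fun hne => hx a b hne hab⟩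
  rw [h]
  refine dense_iInter_of_isOpen
    (fun p => isOpen_ne_fun (continuous_apply _) (continuous_apply _)) fun ⟨⟨a, b⟩, hab⟩ => ?_
  intro x
  have hlim : Filter.Tendsto (fun ε : ℝ => x + ε • (Pi.single a 1 : Fin n → ℝ))
      (nhdsWithin 0 {0}ᶜ) (nhds x) := by
    have : Continuous fun ε : ℝ => x + ε • (Pi.single a 1 : Fin n → ℝ) := by fun_prop
    simpa using (this.tendsto 0).mono_left nhdsWithin_le_nhds
  have hev : ∀ᶠ ε : ℝ in nhdsWithin 0 {0}ᶜ, ε ≠ x b - x a := by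
    by_cases h0 : x b - x a = 0
    · rw [h0]
      exact eventually_mem_nhdsWithin
    · exact nhdsWithin_le_nhds (isOpen_ne.mem_nhds (Ne.symm h0))
  refine mem_closure_of_tendsto hlim (hev.mono fun ε hε => ?_)
  have hab' : b ≠ a := Ne.symm hab
  simp only [Set.mem_ofPred_eq, Pi.add_apply, Pi.smul_apply, Pi.single_eq_same, smul_eq_mul,
    mul_one, Pi.single_eq_of_ne hab', mul_zero, add_zero]
  intro hx
  exact hε (by linarith)

theorem divDiff_recurrence {f : ℝ → ℝ} (hf : ContDiff ℝ (⊤ : ℕ∞) f) {m : ℕ}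
    (x : Fin (m + 2) → ℝ) (i j : Fin (m + 2)) :
    (x i - x j) * divDiff f x =
      divDiff f (x ∘ j.succAbove) - divDiff f (x ∘ i.succAbove) := by
  have hcomp : ∀ i : Fin (m + 2),
      Continuous fun x : Fin (m + 2) → ℝ => divDiff f (x ∘ i.succAbove) := fun i =>
    (continuous_divDiff hf m).comp
      (continuous_pi fun a => continuous_apply (i.succAbove a))
  refine congrFun (Continuous.ext_on (dense_injective (m + 2))
    (((continuous_apply i).sub (continuous_apply j)).mul (continuous_divDiff hf (m + 1)))
    ((hcomp j).sub (hcomp i)) fun x hx => ?_) x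
  have hx : Function.Injective x := hx
  change (x i - x j) * divDiff f x =
    divDiff f (x ∘ j.succAbove) - divDiff f (x ∘ i.succAbove)
  rw [divDiff_eq_lagrangeSum hf hx,
    divDiff_eq_lagrangeSum hf (hx.comp Fin.succAbove_right_injective),
    divDiff_eq_lagrangeSum hf (hx.comp Fin.succAbove_right_injective)]
  exact lagrangeSum_recurrence f hx i j

theorem wDivDiff_recurrence {f : ℝ → ℝ} (hf : ContDiff ℝ (⊤ : ℕ∞) f) {m : ℕ}
    (x : Fin (m + 2) → ℝ) (i j : Fin (m + 2)) :
    (x i - x j) * wDivDiff f x =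
      x i * wDivDiff f (x ∘ i.succAbove) - x j * wDivDiff f (x ∘ j.succAbove) := by
  have hf' : ContDiff ℝ (⊤ : ℕ∞) (deriv f) := (contDiff_infty_iff_deriv.1 hf).2
  have h := divDiff_recurrence hf' x i j
  have hi := Fin.prod_univ_succAbove x i
  have hj := Fin.prod_univ_succAbove x j
  simp only [wDivDiff, Function.comp_apply]
  calc _ = (-1) ^ (m + 2) * (∏ a, x a) * ((x i - x j) * divDiff (deriv f) x) := by ring
    _ = (-1) ^ (m + 2) * (∏ a, x a) * divDiff (deriv f) (x ∘ j.succAbove) -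
        (-1) ^ (m + 2) * (∏ a, x a) * divDiff (deriv f) (x ∘ i.succAbove) := by rw [h]; ring
    _ = (-1) ^ (m + 2) * (x j * ∏ a, x (j.succAbove a)) * divDiff (deriv f) (x ∘ j.succAbove) -
        (-1) ^ (m + 2) * (x i * ∏ a, x (i.succAbove a)) *
          divDiff (deriv f) (x ∘ i.succAbove) := by rw [← hi, ← hj]
    _ = _ := by ring

/-- The argument in the integral formula lies in every convex set containing all the nodes. -/
theorem simplexPoint_mem {s : Set ℝ} (hs : Convex ℝ s) {m : ℕ} {x : Fin (m + 1) → ℝ}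
    (hx : ∀ i, x i ∈ s) {t : Fin m → ℝ} (ht : t ∈ orderSimplex m) : simplexPoint x t ∈ s := by
  induction m with
  | zero => simpa [simplexPoint] using hx 0
  | succ m ih =>
    obtain ⟨u, t, rfl⟩ : ∃ u t', t = Fin.cons u t' := ⟨t 0, Fin.tail t, (Fin.cons_self_tail t).symm⟩
    obtain ⟨ht', hu0, hu1⟩ := (cons_mem_orderSimplex u t).1 ht
    have h0 : simplexPoint (x ∘ Fin.succAbove 0) t ∈ s := ih (fun i => hx _) ht'
    have h1 : simplexPoint (x ∘ Fin.succAbove 1) t ∈ s := ih (fun i => hx _) ht'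
    rw [← simplexPoint_cons_consBound, simplexPoint_cons] at h1
    rw [simplexPoint_cons]
    rcases eq_or_lt_of_le (hu0.trans hu1) with hb | hb
    · have : u = 0 := le_antisymm (hb ▸ hu1) hu0
      simpa [this] using h0
    · have := hs.add_smul_mem h0 (y := (x 0 - x 1) * consBound t) h1
        (t := u / consBound t) ⟨by positivity, (div_le_one hb).2 hu1⟩
      have he : (u / consBound t) • ((x 0 - x 1) * consBound t) = (x 0 - x 1) * u := by
        rw [smul_eq_mul]
        field_simp
      rwa [he] at this

theorem divDiff_deriv_eq_setIntegral (f : ℝ → ℝ) {m : ℕ} (x : Fin (m + 1) → ℝ) :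
    divDiff (deriv f) x = ∫ t in orderSimplex m, iteratedDeriv (m + 1) f (simplexPoint x t) := by
  simp only [divDiff_eq_setIntegral, iteratedDeriv_succ']

theorem wDivDiff_nonneg_of_pos {f : ℝ → ℝ} {r : ℝ} {m : ℕ}
    (hpos : ∀ y, r ≤ y → 0 ≤ (-1 : ℝ) ^ (m + 1) * iteratedDeriv (m + 1) f y)
    {x : Fin (m + 1) → ℝ} (hx : ∀ i, r ≤ x i) (hx0 : ∀ i, 0 ≤ x i) : 0 ≤ wDivDiff f x := by
  rw [wDivDiff, divDiff_deriv_eq_setIntegral, mul_comm ((-1 : ℝ) ^ (m + 1)), mul_assoc,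
    ← integral_const_mul]
  refine mul_nonneg (Finset.prod_nonneg fun i _ => hx0 i) ?_
  refine setIntegral_nonneg (isCompact_orderSimplex m).isClosed.measurableSet fun t ht => ?_
  exact hpos _ (simplexPoint_mem (convex_Ici r) hx ht)

theorem wDivDiff_nonneg_of_neg {f : ℝ → ℝ} {r : ℝ} {m : ℕ}
    (hneg : ∀ y, y ≤ r → 0 ≤ iteratedDeriv (m + 1) f y)
    {x : Fin (m + 1) → ℝ} (hx : ∀ i, x i ≤ r) (hx0 : ∀ i, x i ≤ 0) : 0 ≤ wDivDiff f x := by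
  have hprod : (-1 : ℝ) ^ (m + 1) * ∏ i, x i = ∏ i, -x i := by simp [Finset.prod_neg]
  rw [wDivDiff, divDiff_deriv_eq_setIntegral, hprod]
  refine mul_nonneg (Finset.prod_nonneg fun i _ => neg_nonneg.2 (hx0 i)) ?_
  refine setIntegral_nonneg (isCompact_orderSimplex m).isClosed.measurableSet fun t ht => ?_
  exact hneg _ (simplexPoint_mem (convex_Iic r) hx ht)

theorem wDivDiff_nonneg {f : ℝ → ℝ} (hf : ContDiff ℝ (⊤ : ℕ∞) f) {r : ℝ} (hr : 0 < r) {m : ℕ}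
    (hneg : ∀ k ≤ m + 1, ∀ y ≤ -r, 0 ≤ iteratedDeriv k f y)
    (hpos : ∀ k ≤ m + 1, ∀ y, r ≤ y → 0 ≤ (-1 : ℝ) ^ k * iteratedDeriv k f y)
    {x : Fin (m + 1) → ℝ} (hx : ∀ i, r ≤ |x i|) : 0 ≤ wDivDiff f x := by
  by_cases h1 : ∀ i, 0 ≤ x i
  · exact wDivDiff_nonneg_of_pos (hpos _ le_rfl) (fun i => abs_of_nonneg (h1 i) ▸ hx i) h1
  by_cases h2 : ∀ i, x i ≤ 0
  · exact wDivDiff_nonneg_of_neg (hneg _ le_rfl)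
      (fun i => le_neg_of_le_neg (abs_of_nonpos (h2 i) ▸ hx i)) h2
  push Not at h1 h2
  obtain ⟨j, hj⟩ := h1
  obtain ⟨i, hi⟩ := h2
  cases m with
  | zero =>
    rw [Fin.eq_zero i, ← Fin.eq_zero j] at hi
    exact absurd hi hj.not_gt
  | succ m =>
    have hsub : ∀ l : Fin (m + 2), 0 ≤ wDivDiff f (x ∘ l.succAbove) := fun l =>
      wDivDiff_nonneg hf hr (fun k hk => hneg k (by omega)) (fun k hk => hpos k (by omega))
        fun i => hx _
    have h := wDivDiff_recurrence hf x i j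
    have hi' := mul_nonneg hi.le (hsub i)
    have hj' := mul_nonneg (neg_nonneg.2 hj.le) (hsub j)
    exact nonneg_of_mul_nonneg_right (a := x i - x j) (by linarith) (by linarith)

/-- under the sign assumptions on the derivatives of `f`, for
points `max_{k ≤ n} R_k < |x_1| ≤ ⋯ ≤ |x_n|` (with `n ≥ 2`; here the number of
points is `n + 2`) such that some `x_k` with `k` not the last index has sign opposite
to `x_n`, one has `|f'{x_1,…,x_n}| ≥ (1/2) |f'{x_1,…,x_{n−1}}|`. -/
theorem statement18 (f : ℝ → ℝ) (hf : ContDiff ℝ (⊤ : ℕ∞) f) (R : ℕ → ℝ)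
    (hRpos : ∀ n : ℕ, 0 < R n)
    (hneg : ∀ n : ℕ, ∀ x : ℝ, x < -R n → 0 < iteratedDeriv n f x)
    (hpos : ∀ n : ℕ, ∀ x : ℝ, R n < x → 0 < (-1 : ℝ) ^ n * iteratedDeriv n f x)
    (n : ℕ) (x : Fin (n + 2) → ℝ)
    (hsmall : ∀ k : ℕ, k ≤ n + 2 → R k < |x 0|)
    (hmono : Monotone fun j => |x j|)
    (k : Fin (n + 1)) (hsign : x k.castSucc * x (Fin.last (n + 1)) < 0) :
    (1 / 2 : ℝ) * |wDivDiff f (x ∘ Fin.castSucc)| ≤ |wDivDiff f x| := by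
  have hr : 0 < |x 0| := (hRpos 0).trans (hsmall 0 (Nat.zero_le _))
  have hn : ∀ k ≤ n + 2, ∀ y ≤ -|x 0|, 0 ≤ iteratedDeriv k f y := fun k hk y hy =>
    (hneg k y (by linarith [hsmall k hk])).le
  have hp : ∀ k ≤ n + 2, ∀ y, |x 0| ≤ y → 0 ≤ (-1 : ℝ) ^ k * iteratedDeriv k f y :=
    fun k hk y hy => (hpos k y (by linarith [hsmall k hk])).le
  have hx : ∀ i, |x 0| ≤ |x i| := fun i => hmono (Fin.zero_le i)
  have hsub : ∀ l : Fin (n + 2), 0 ≤ wDivDiff f (x ∘ l.succAbove) := fun l =>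
    wDivDiff_nonneg hf hr (fun k hk => hn k (by omega)) (fun k hk => hp k (by omega))
      fun i => hx _
  have hall : 0 ≤ wDivDiff f x := wDivDiff_nonneg hf hr hn hp hx
  have hlast := hsub (Fin.last (n + 1))
  have hk := hsub k.castSucc
  have hrec := wDivDiff_recurrence hf x (Fin.last (n + 1)) k.castSucc
  have habs : |x k.castSucc| ≤ |x (Fin.last (n + 1))| := hmono (Fin.le_last _)
  have hcomp : x ∘ Fin.castSucc = x ∘ (Fin.last (n + 1)).succAbove := by
    rw [Fin.succAbove_last]
  rw [hcomp, abs_of_nonneg hlast, abs_of_nonneg hall]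
  set a := x (Fin.last (n + 1))
  set b := x k.castSucc
  rcases mul_neg_iff.1 hsign with ⟨hb, ha⟩ | ⟨hb, ha⟩
  · rw [abs_of_pos hb, abs_of_neg ha] at habs
    nlinarith
  · rw [abs_of_neg hb, abs_of_pos ha] at habs
    nlinarith
end
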